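/- arXiv:2005.02896 — 3 statements merged into one kernel-verified Lean document; each statement's English description precedes it below -/
import Mathlib

section
/- There exists a real number α ≥ 1 such that for every α-critical pair (G, f), the graph G contains a hole-with-hat. -/
open Finset

namespace EHhat

variable {V : Type*}

/-- `c : ZMod n → V` describes a hole (induced cycle of length `n ≥ 4`) in `G`. -/
def IsHole (G : SimpleGraph V) (n : ℕ) (c : ZMod n → V) : Prop :=
  4 ≤ n ∧ Function.Injective c ∧
    ∀ i j : ZMod n, G.Adj (c i) (c j) ↔ (i - j = 1 ∨ j - i = 1)

/-- `G` contains a hole together with a hat: a vertex outside the hole with exactly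
two neighbours on the hole, and these two neighbours are adjacent (consecutive). -/
def HasHoleWithHat (G : SimpleGraph V) : Prop :=
  ∃ (n : ℕ) (c : ZMod n → V) (v : V) (i : ZMod n),
    IsHole G n c ∧ (∀ j, v ≠ c j) ∧ (∀ j, G.Adj v (c j) ↔ (j = i ∨ j = i + 1))

def HoleWithHatFree (G : SimpleGraph V) : Prop := ¬ HasHoleWithHat G

/-- A graph is perfect if chromatic number equals clique number for
every induced subgraph. -/
def IsPerfect [Fintype V] (G : SimpleGraph V) : Prop :=
  ∀ S : Finset V,
    (G.induce (S : Set V)).chromaticNumber = ((G.induce (S : Set V)).cliqueNum : ℕ∞)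

/-- `f` is a good function on `G`: it is nonnegative and sums to at most 1 on
every perfect induced subgraph of `G`. -/
def GoodOn [Fintype V] (G : SimpleGraph V) (f : V → ℝ) : Prop :=
  (∀ v, 0 ≤ f v) ∧
  ∀ S : Finset V, IsPerfect (G.induce (S : Set V)) → ∑ v ∈ S, f v ≤ 1

/-- `G` is `α`-narrow if `∑ v, f v ^ α ≤ 1` for every good function `f` on `G`. -/
def Narrow [Fintype V] (G : SimpleGraph V) (α : ℝ) : Prop :=
  ∀ f : V → ℝ, GoodOn G f → ∑ v, f v ^ α ≤ 1

/-- `(G, f)` is an `α`-critical pair. -/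
def Critical [Fintype V] (G : SimpleGraph V) (f : V → ℝ) (α : ℝ) : Prop :=
  GoodOn G f ∧
  (∀ S : Finset V, S ≠ Finset.univ → Narrow (G.induce (S : Set V)) α) ∧
  1 < ∑ v, f v ^ α

/-- `A` is complete to `B`. -/
def CompleteTo (G : SimpleGraph V) (A B : Set V) : Prop :=
  ∀ a ∈ A, ∀ b ∈ B, G.Adj a b

/-- `A` is anticomplete to `B`. -/
def AnticompleteTo (G : SimpleGraph V) (A B : Set V) : Prop :=
  ∀ a ∈ A, ∀ b ∈ B, ¬ G.Adj a b

/-- The vertex `v` is complete to the set `C`. -/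
def VertCompleteTo (G : SimpleGraph V) (v : V) (C : Set V) : Prop :=
  ∀ c ∈ C, G.Adj v c

/-- The vertex `v` is mixed on `C`: it has both a neighbour and a non-neighbour in `C`. -/
def MixedOn (G : SimpleGraph V) (v : V) (C : Set V) : Prop :=
  (∃ c ∈ C, G.Adj v c) ∧ (∃ c ∈ C, ¬ G.Adj v c)

/-- `X ⊆ V(G)` is connected: `G[X]` is a connected graph. -/
def ConnSet (G : SimpleGraph V) (X : Set V) : Prop :=
  (G.induce X).Connected

/-- `X ⊆ V(G)` is anticonnected: the complement of `G[X]` is a connected graph. -/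
def AnticonnSet (G : SimpleGraph V) (X : Set V) : Prop :=
  ((G.induce X)ᶜ).Connected

/-- The sum of `f` over a set `X` of vertices. -/
noncomputable def setSum [Fintype V] (f : V → ℝ) (X : Set V) : ℝ :=
  ∑ v, X.indicator f v

/-- `w` is a weight function making `(G, w)` a weighted graph. -/
def IsWeight [Fintype V] (w : V → ℝ) : Prop :=
  (∀ v, 0 ≤ w v) ∧ ∑ v, w v = 1

/-- The weighted graph `(G, w)` is `ε`-coherent. -/
def Coherent [Fintype V] (G : SimpleGraph V) (w : V → ℝ) (ε : ℝ) : Prop :=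
  (∀ v, w v < ε) ∧
  (∀ v, setSum w (G.neighborSet v) < ε) ∧
  ∀ A B : Set V, Disjoint A B → AnticompleteTo G A B →
    min (setSum w A) (setSum w B) < ε

/-- `Y` is (the vertex set of) a component of `G[X]`: a maximal connected subset of `X`. -/
def IsCompOf (G : SimpleGraph V) (X Y : Set V) : Prop :=
  Y ⊆ X ∧ ConnSet G Y ∧
  ∀ Z : Set V, Y ⊆ Z → Z ⊆ X → ConnSet G Z → Z = Y

/-- `Y` is the big component of `G[X]` (with respect to the weight `w` and `ε`). -/
def IsBigComp [Fintype V] (G : SimpleGraph V) (w : V → ℝ) (ε : ℝ) (X Y : Set V) : Prop :=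
  IsCompOf G X Y ∧ setSum w X - ε < setSum w Y

/-- `v` is an attachment of `A`: a vertex outside `A` with a neighbour in `A`. -/
def IsAttachment (G : SimpleGraph V) (A : Set V) (v : V) : Prop :=
  v ∉ A ∧ ∃ a ∈ A, G.Adj v a

/-- `(C, D)` is a split of the weighted graph `(G, w)`. -/
def IsSplit [Fintype V] (G : SimpleGraph V) (w : V → ℝ) (ε : ℝ) (C D : Set V) : Prop :=
  Disjoint C D ∧ 2 ≤ C.ncard ∧ ConnSet G C ∧ AnticonnSet G C ∧
  D.Nonempty ∧ D = {v | v ∉ C ∧ ∀ c ∈ C, G.Adj v c} ∧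
  ∀ Y : Set V, IsBigComp G w ε ((C ∪ D)ᶜ) Y → ∀ c ∈ C, ¬ IsAttachment G Y c

/-- A split is optimal if its first part is maximal among splits. -/
def IsOptimalSplit [Fintype V] (G : SimpleGraph V) (w : V → ℝ) (ε : ℝ) (C D : Set V) : Prop :=
  IsSplit G w ε C D ∧ ∀ C' D' : Set V, IsSplit G w ε C' D' → C ⊆ C' → C' = C

/-- `(A, C, D, B)` is a fracture of `(G, w)`: `(C, D)` is an optimal split, `A` is the union
of the components of `G \ (C ∪ D)` with an attachment in `C`, and `B` is the rest. -/
def IsFracture [Fintype V] (G : SimpleGraph V) (w : V → ℝ) (ε : ℝ)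
    (A C D B : Set V) : Prop :=
  IsOptimalSplit G w ε C D ∧
  A = {v | ∃ Y : Set V, IsCompOf G ((C ∪ D)ᶜ) Y ∧ v ∈ Y ∧ ∃ c ∈ C, IsAttachment G Y c} ∧
  B = ((C ∪ D)ᶜ : Set V) \ A

/-- The generating relation for the forcer graph: vertices `0,1,2,3` and `4,5,6,7`
each induce a path, and the two quadruples are complete to each other. -/
def forcerRel (i j : Fin 8) : Prop :=
  (i.val < 4 ∧ 4 ≤ j.val) ∨ j.val = i.val + 1

/-- The forcer graph. -/
def forcer : SimpleGraph (Fin 8) := SimpleGraph.fromRel forcerRel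

def ForcerFree (G : SimpleGraph V) : Prop := IsEmpty (forcer ↪g G)

/-- Given an embedded copy of the forcer via the vertex map `f`, one of its two
constituent paths has all its vertices in `S`. -/
def ConstituentPathIn (f : Fin 8 → V) (S : Set V) : Prop :=
  (∀ i : Fin 8, i.val < 4 → f i ∈ S) ∨ (∀ i : Fin 8, 4 ≤ i.val → f i ∈ S)

/-- `X` is a homogeneous set of `H`. -/
def IsHomogeneousSet {W : Type*} (H : SimpleGraph W) (X : Set W) : Prop :=
  ∀ v ∉ X, (∀ x ∈ X, H.Adj v x) ∨ (∀ x ∈ X, ¬ H.Adj v x)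

/-- `H` is guarded: for each forcer in `H` there is a proper homogeneous set
containing a constituent path of the forcer. -/
def Guarded {W : Type*} (H : SimpleGraph W) : Prop :=
  ∀ f : forcer ↪g H, ∃ X : Set W,
    X ≠ Set.univ ∧ IsHomogeneousSet H X ∧ ConstituentPathIn (fun i => f i) X

/-- The house: the complement of the five-vertex path. -/
def house : SimpleGraph (Fin 5) := (SimpleGraph.pathGraph 5)ᶜ

def HouseFree (G : SimpleGraph V) : Prop := IsEmpty (house ↪g G)

/-- `g` is a good function on the induced subgraph `G[X]`. -/
def GoodOnSub [Fintype V] (G : SimpleGraph V) (X : Set V) (g : V → ℝ) : Prop :=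
  (∀ v ∈ X, 0 ≤ g v) ∧
  ∀ S : Finset V, (S : Set V) ⊆ X → IsPerfect (G.induce (S : Set V)) →
    ∑ v ∈ S, g v ≤ 1


section

open scoped Classical

/-- A nonempty finite set of vertices with an edge across each of its proper cuts. -/
def Linked (G : SimpleGraph V) (Y : Finset V) : Prop :=
  Y.Nonempty ∧ ∀ A ⊆ Y, A.Nonempty → A ≠ Y → ∃ a ∈ A, ∃ b ∈ Y, b ∉ A ∧ G.Adj a b

theorem linked_singleton (G : SimpleGraph V) (x : V) : Linked G {x} := by
  refine ⟨singleton_nonempty x, fun A hA hne h => absurd ?_ h⟩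
  exact (subset_singleton_iff.1 hA).resolve_left hne.ne_empty

theorem Linked.insert_of_adj {G : SimpleGraph V} {Y : Finset V} (hY : Linked G Y) {x y : V}
    (hy : y ∈ Y) (hxy : G.Adj x y) : Linked G (insert x Y) := by
  refine ⟨insert_nonempty x Y, fun A hA hne hAY => ?_⟩
  by_cases hE : (A ∩ Y).Nonempty
  · by_cases hAe : A ∩ Y = Y
    · have hYA : Y ⊆ A := hAe ▸ inter_subset_left
      have hx : x ∉ A := fun hx => hAY (hA.antisymm (insert_subset hx hYA))
      exact ⟨y, hYA hy, x, mem_insert_self x Y, hx, hxy.symm⟩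
    · obtain ⟨a, ha, b, hb, hbA, hab⟩ := hY.2 _ inter_subset_right hE hAe
      exact ⟨a, (mem_inter.1 ha).1, b, mem_insert_of_mem hb,
        fun h => hbA (mem_inter.2 ⟨h, hb⟩), hab⟩
  · obtain ⟨a, ha⟩ := hne
    have hA' : ∀ z ∈ A, z = x := fun z hz => (mem_insert.1 (hA hz)).resolve_right
      fun h => hE ⟨z, mem_inter.2 ⟨hz, h⟩⟩
    have hax := hA' a ha
    subst hax
    exact ⟨a, ha, y, mem_insert_of_mem hy, fun h => hE ⟨y, mem_inter.2 ⟨h, hy⟩⟩, hxy⟩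

/-- Every vertex of a linked set can be avoided when deleting a suitable vertex. -/
theorem Linked.exists_erase {G : SimpleGraph V} {Y : Finset V} (hY : Linked G Y) {z : V}
    (hz : z ∈ Y) (hne : Y ≠ {z}) : ∃ t ∈ Y, t ≠ z ∧ Linked G (Y.erase t) := by
  have hcand : ({z} : Finset V) ∈ Y.powerset.filter (fun M => z ∈ M ∧ Linked G M ∧ M ≠ Y) := by
    simp [hz, linked_singleton, hne.symm]
  obtain ⟨M, hM, hmax⟩ := exists_max_image _ card ⟨_, hcand⟩
  simp only [mem_filter, mem_powerset] at hM hmax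
  obtain ⟨hMY, hzM, hML, hMne⟩ := hM
  obtain ⟨a, ha, t, ht, htM, hat⟩ := hY.2 M hMY ⟨z, hzM⟩ hMne
  have hL := hML.insert_of_adj ha hat.symm
  have hEq : Y = insert t M := by
    by_contra hne'
    have := hmax (insert t M) ⟨insert_subset ht hMY, mem_insert_of_mem hzM, hL, Ne.symm hne'⟩
    rw [card_insert_of_notMem htM] at this
    omega
  refine ⟨t, ht, fun h => htM (h ▸ hzM), ?_⟩
  rwa [hEq, erase_insert htM]

theorem exists_walk {G : SimpleGraph V} {Y : Finset V} (hY : Linked G Y) {P : V → Prop}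
    (hP : ∃ y ∈ Y, P y) {b : V} (hb : b ∈ Y) :
    ∃ (n : ℕ) (q : ℕ → V), (∀ i ≤ n, q i ∈ Y) ∧ (∀ i < n, G.Adj (q i) (q (i + 1))) ∧
      P (q 0) ∧ q n = b := by
  set A := Y.filter fun b => ∃ (n : ℕ) (q : ℕ → V), (∀ i ≤ n, q i ∈ Y) ∧
    (∀ i < n, G.Adj (q i) (q (i + 1))) ∧ P (q 0) ∧ q n = b with hA
  suffices h : A = Y by
    rw [← h, hA, mem_filter] at hb
    exact hb.2
  by_contra hne
  obtain ⟨y, hy, hPy⟩ := hP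
  have hyA : y ∈ A := by
    rw [hA, mem_filter]
    exact ⟨hy, 0, fun _ => y, fun _ _ => hy, fun i hi => absurd hi (by omega), hPy, rfl⟩
  obtain ⟨a, ha, b, hb, hbA, hab⟩ := hY.2 A (filter_subset _ _) ⟨y, hyA⟩ hne
  rw [hA, mem_filter] at ha
  obtain ⟨-, n, q, hq, hadj, h0, hn⟩ := ha
  refine hbA ?_
  rw [hA, mem_filter]
  refine ⟨hb, n + 1, fun i => if i ≤ n then q i else b, fun i _ => ?_, fun i hi => ?_, ?_, ?_⟩
  · dsimp only
    split_ifs with h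
    exacts [hq i h, hb]
  · rcases Nat.lt_or_ge i n with h | h
    · simpa [h.le, Nat.succ_le_of_lt h] using hadj i h
    · have : i = n := by omega
      subst this
      simpa [hn] using hab
  · simpa using h0
  · simp

theorem zmod_sub_eq_one_iff {n : ℕ} (i j : ZMod (n + 3)) :
    i - j = 1 ↔ i.val = j.val + 1 ∨ (i.val = 0 ∧ j.val = n + 2) := by
  have h1 : (1 : ZMod (n + 3)).val = 1 := ZMod.val_one'' (by omega)
  have hj := ZMod.val_lt j
  have hi := ZMod.val_lt i
  rw [sub_eq_iff_eq_add', ← (ZMod.val_injective (n + 3)).eq_iff, ZMod.val_add, h1]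
  rcases Nat.lt_or_ge (j.val + 1) (n + 3) with h | h
  · rw [Nat.mod_eq_of_lt h]
    omega
  · have : j.val + 1 = n + 3 := by omega
    rw [this, Nat.mod_self]
    omega

/-- An edge `u e` whose ends attach to a linked set missing a common neighbour `x` of `u` and `e`
has a common neighbour in the set, unless there is a hole with a hat. -/
theorem exists_common_neighbor {G : SimpleGraph V} (hG : ¬ HasHoleWithHat G) {Y : Finset V}
    (hY : Linked G Y) {x u e : V} (hue : G.Adj u e) (hxu : G.Adj x u) (hxe : G.Adj x e)
    (hx : ∀ y ∈ Y, ¬ G.Adj x y) (hu : ∃ y ∈ Y, G.Adj u y) (he : ∃ y ∈ Y, G.Adj e y) :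
    ∃ y ∈ Y, G.Adj u y ∧ G.Adj e y := by
  by_contra hno
  push Not at hno
  have huY : u ∉ Y := fun h => hx u h hxu
  have heY : e ∉ Y := fun h => hx e h hxe
  have hxY : x ∉ Y := fun h => hno x h hxu.symm hxe.symm
  have hex : ∃ n, ∃ q : ℕ → V, (∀ i ≤ n, q i ∈ Y) ∧ (∀ i < n, G.Adj (q i) (q (i + 1))) ∧
      G.Adj u (q 0) ∧ G.Adj e (q n) := by
    obtain ⟨b, hb, heb⟩ := he
    obtain ⟨n, q, h1, h2, h3, h4⟩ := exists_walk hY hu hb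
    exact ⟨n, q, h1, h2, h3, h4 ▸ heb⟩
  obtain ⟨q, hq, hadj, h0, hn⟩ := Nat.find_spec hex
  have hmin := fun k (hk : k < Nat.find hex) => Nat.find_min hex hk
  set n := Nat.find hex
  have hu' : ∀ i ≤ n, G.Adj u (q i) → i = 0 := by
    intro i hi hadi
    by_contra hi0
    refine hmin (n - i) (by omega) ⟨fun j => q (i + j), fun j hj => hq _ (by omega),
      fun j hj => hadj (i + j) (by omega), hadi, ?_⟩
    simpa [Nat.add_sub_cancel' hi] using hn
  have he' : ∀ i ≤ n, G.Adj e (q i) → i = n := by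
    intro i hi hadi
    by_contra hin
    exact hmin i (by omega) ⟨q, fun j hj => hq _ (by omega), fun j hj => hadj j (by omega), h0, hadi⟩
  have hq' : ∀ i j, i < j → j ≤ n → G.Adj (q i) (q j) → j = i + 1 := by
    intro i j hij hj hadi
    by_contra hji
    refine hmin (n - (j - i - 1)) (by omega)
      ⟨fun k => if k ≤ i then q k else q (k + (j - i - 1)), fun k hk => ?_, fun k hk => ?_, ?_, ?_⟩
    · dsimp only
      split_ifs
      exacts [hq _ (by omega), hq _ (by omega)]
    · rcases lt_trichotomy k i with h | h | h
      · simpa [h.le, Nat.succ_le_of_lt h] using hadj k (by omega)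
      · subst h
        have : k + 1 + (j - k - 1) = j := by omega
        simpa [this] using hadi
      · have h1 : ¬ k ≤ i := by omega
        have h2 : ¬ k + 1 ≤ i := by omega
        have h3 : k + 1 + (j - i - 1) = k + (j - i - 1) + 1 := by omega
        simpa only [h1, h2, if_false, h3] using hadj (k + (j - i - 1)) (by omega)
    · simpa using h0
    · have h1 : ¬ n - (j - i - 1) ≤ i := by omega
      have h2 : n - (j - i - 1) + (j - i - 1) = n := by omega
      simpa only [h1, if_false, h2] using hn
  have hinj : ∀ i j, i < j → j ≤ n → q i ≠ q j := by
    intro i j hij hj heq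
    rcases Nat.lt_or_ge j n with h | h
    · have := hq' i (j + 1) (by omega) (by omega) (heq ▸ hadj j h)
      omega
    · have hjn : j = n := by omega
      have := he' i (by omega) (by rw [heq, hjn]; exact hn)
      omega
  have hn1 : 1 ≤ n := by
    by_contra h
    have hn0 : n = 0 := by omega
    rw [hn0] at hn
    exact hno _ (hq 0 (by omega)) h0 hn
  have hqq : ∀ i j, i ≤ n → j ≤ n → (G.Adj (q i) (q j) ↔ (i = j + 1 ∨ j = i + 1)) := by
    intro i j hi hj
    constructor
    · intro h
      rcases lt_trichotomy i j with hlt | hlt | hlt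
      · exact Or.inr (hq' i j hlt hj h)
      · subst hlt
        exact absurd h (G.loopless.irrefl _)
      · exact Or.inl (hq' j i hlt hi h.symm)
    · rintro (h | h)
      · subst h
        exact (hadj j (by omega)).symm
      · subst h
        exact hadj i (by omega)
  have huq : ∀ i ≤ n, (G.Adj u (q i) ↔ i = 0) := fun i hi => ⟨hu' i hi, fun h => h ▸ h0⟩
  have heq : ∀ i ≤ n, (G.Adj e (q i) ↔ i = n) := fun i hi => ⟨he' i hi, fun h => h ▸ hn⟩
  let c : ZMod (n + 3) → V := fun i =>
    if i.val ≤ n then q i.val else if i.val = n + 1 then e else u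
  have hc : ∀ i : ZMod (n + 3), (i.val ≤ n ∧ c i = q i.val) ∨ (i.val = n + 1 ∧ c i = e) ∨
      (i.val = n + 2 ∧ c i = u) := by
    intro i
    have := ZMod.val_lt i
    by_cases h1 : i.val ≤ n
    · exact Or.inl ⟨h1, by simp [c, h1]⟩
    · by_cases h2 : i.val = n + 1
      · exact Or.inr (Or.inl ⟨h2, by simp [c, h2]⟩)
      · exact Or.inr (Or.inr ⟨by omega, by simp [c, h1, h2]⟩)
  have hxq : ∀ i ≤ n, ¬ G.Adj x (q i) := fun i hi => hx _ (hq i hi)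
  have hidx : ((n + 1 : ℕ) : ZMod (n + 3)).val = n + 1 :=
    ZMod.val_natCast_of_lt (by omega)
  refine hG ⟨n + 3, c, x, ((n + 1 : ℕ) : ZMod (n + 3)), ⟨by omega, ?_, ?_⟩, ?_, ?_⟩
  · intro i j hij
    apply ZMod.val_injective
    rcases hc i with ⟨hi, hi'⟩ | ⟨hi, hi'⟩ | ⟨hi, hi'⟩ <;>
      rcases hc j with ⟨hj, hj'⟩ | ⟨hj, hj'⟩ | ⟨hj, hj'⟩ <;> rw [hi', hj'] at hij
    · rcases lt_trichotomy i.val j.val with h | h | h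
      · exact absurd hij (hinj _ _ h hj)
      · exact h
      · exact absurd hij.symm (hinj _ _ h hi)
    · exact absurd (hij ▸ hq _ hi) heY
    · exact absurd (hij ▸ hq _ hi) huY
    · exact absurd (hij ▸ hq _ hj) heY
    · omega
    · exact absurd hij.symm hue.ne
    · exact absurd (hij ▸ hq _ hj) huY
    · exact absurd hij hue.ne
    · omega
  · intro i j
    rw [zmod_sub_eq_one_iff, zmod_sub_eq_one_iff]
    rcases hc i with ⟨hi, hi'⟩ | ⟨hi, hi'⟩ | ⟨hi, hi'⟩ <;>
      rcases hc j with ⟨hj, hj'⟩ | ⟨hj, hj'⟩ | ⟨hj, hj'⟩ <;> rw [hi', hj']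
    · rw [hqq _ _ hi hj]
      omega
    · rw [G.adj_comm, heq _ hi]
      omega
    · rw [G.adj_comm, huq _ hi]
      omega
    · rw [heq _ hj]
      omega
    · simp only [SimpleGraph.irrefl, false_iff]
      omega
    · simp only [hue.symm, true_iff]
      omega
    · rw [huq _ hj]
      omega
    · simp only [hue, true_iff]
      omega
    · simp only [SimpleGraph.irrefl, false_iff]
      omega
  · intro j
    rcases hc j with ⟨hj, hj'⟩ | ⟨hj, hj'⟩ | ⟨hj, hj'⟩ <;> rw [hj']
    · exact fun h => hxY (h ▸ hq _ hj)
    · exact hxe.ne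
    · exact hxu.ne
  · intro j
    rw [← sub_eq_iff_eq_add', zmod_sub_eq_one_iff, hidx, ← (ZMod.val_injective (n + 3)).eq_iff, hidx]
    rcases hc j with ⟨hj, hj'⟩ | ⟨hj, hj'⟩ | ⟨hj, hj'⟩ <;> rw [hj']
    · simp only [hxq _ hj, false_iff]
      omega
    · simp only [hxe, true_iff]
      omega
    · simp only [hxu, true_iff]
      omega


/-- Every natural weighting `n` has a clique `K ⊆ S` and an `n`-fold colouring of `S` using
as many colours as the weight of `K`. -/
def WPerf (G : SimpleGraph V) (S : Finset V) : Prop :=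
  ∀ n : V → ℕ, ∃ K ⊆ S, G.IsClique (K : Set V) ∧ ∃ c : V → Finset ℕ,
    (∀ x ∈ S, (c x).card = n x ∧ c x ⊆ range (∑ y ∈ K, n y)) ∧
    ∀ x ∈ S, ∀ y ∈ S, G.Adj x y → Disjoint (c x) (c y)

theorem isClique_union {G : SimpleGraph V} {K L : Finset V} (hK : G.IsClique (K : Set V))
    (hL : G.IsClique (L : Set V)) (h : ∀ a ∈ K, ∀ b ∈ L, G.Adj a b) :
    G.IsClique ((K ∪ L : Finset V) : Set V) := by
  intro a ha b hb hab
  rcases mem_union.1 ha with ha | ha <;> rcases mem_union.1 hb with hb | hb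
  exacts [hK ha hb hab, h a ha b hb, (h b hb a ha).symm, hL ha hb hab]

theorem exists_relabel (s : Finset ℕ) {q : ℕ} (hq : q ≤ s.card) :
    ∃ ι : ℕ → ℕ, Set.InjOn ι (range q : Set ℕ) ∧ ∀ i ∈ range q, ι i ∈ s := by
  refine ⟨fun i => if h : i < q then s.orderEmbOfCardLe hq ⟨i, h⟩ else 0, ?_, ?_⟩
  · intro i hi j hj hij
    simp only [coe_range, Set.mem_Iio] at hi hj
    simp only [hi, hj, dif_pos] at hij
    simpa using (s.orderEmbOfCardLe hq).injective hij
  · intro i hi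
    simp only [mem_range] at hi
    simp only [hi, dif_pos]
    exact s.orderEmbOfCardLe_mem hq _

theorem disjoint_image_of_injOn {ι : ℕ → ℕ} {s a b : Finset ℕ} (hι : Set.InjOn ι (s : Set ℕ))
    (ha : a ⊆ s) (hb : b ⊆ s) (hab : Disjoint a b) : Disjoint (a.image ι) (b.image ι) := by
  rw [disjoint_left] at hab ⊢
  intro x hx hx'
  obtain ⟨i, hi, rfl⟩ := mem_image.1 hx
  obtain ⟨j, hj, hji⟩ := mem_image.1 hx'
  have := hι (hb hj) (ha hi) hji
  exact hab hi (this ▸ hj)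

/-- The colouring half of `WPerf`, with colours taken from an arbitrary large enough set. -/
theorem WPerf.exists_coloring_in {G : SimpleGraph V} {Q : Finset V} (hQ : WPerf G Q) (n : V → ℕ) :
    ∃ K ⊆ Q, G.IsClique (K : Set V) ∧ ∀ s : Finset ℕ, ∑ y ∈ K, n y ≤ s.card →
      ∃ c : V → Finset ℕ, (∀ x ∈ Q, (c x).card = n x ∧ c x ⊆ s) ∧
        ∀ x ∈ Q, ∀ y ∈ Q, G.Adj x y → Disjoint (c x) (c y) := by
  obtain ⟨K, hK, hKc, c, hc, hd⟩ := hQ n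
  refine ⟨K, hK, hKc, fun s hs => ?_⟩
  obtain ⟨ι, hι, hιs⟩ := exists_relabel s hs
  refine ⟨fun x => (c x).image ι, fun x hx => ⟨?_, ?_⟩, fun x hx y hy hxy => ?_⟩
  · rw [card_image_of_injOn (hι.mono (by exact_mod_cast (hc x hx).2)), (hc x hx).1]
  · exact image_subset_iff.2 fun i hi => hιs i ((hc x hx).2 hi)
  · exact disjoint_image_of_injOn hι (hc x hx).2 (hc y hy).2 (hd x hx y hy hxy)

theorem wPerf_of_bound {G : SimpleGraph V} {S : Finset V}
    (h : ∀ n : V → ℕ, ∃ K ⊆ S, G.IsClique (K : Set V) ∧ ∃ s : Finset ℕ,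
      s.card ≤ ∑ y ∈ K, n y ∧ ∃ c : V → Finset ℕ, (∀ x ∈ S, (c x).card = n x ∧ c x ⊆ s) ∧
        ∀ x ∈ S, ∀ y ∈ S, G.Adj x y → Disjoint (c x) (c y)) : WPerf G S := by
  intro n
  obtain ⟨K, hK, hKc, s, hs, c, hc, hd⟩ := h n
  obtain ⟨ι, hι, hιs⟩ := exists_relabel (range (∑ y ∈ K, n y)) (q := s.card) (by simpa using hs)
  let e : ℕ → ℕ := fun i => if h : i ∈ s then (s.equivFin ⟨i, h⟩ : ℕ) else 0
  have he : ∀ i ∈ s, e i ∈ range s.card := by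
    intro i hi
    simp only [e, hi, dif_pos, mem_range]
    exact (s.equivFin ⟨i, hi⟩).2
  have hinj : Set.InjOn (ι ∘ e) (s : Set ℕ) := by
    intro i hi j hj hij
    have h1 := hι (he i hi) (he j hj) hij
    have hi' : i ∈ s := hi
    have hj' : j ∈ s := hj
    simp only [e, hi', hj', dif_pos] at h1
    simpa using s.equivFin.injective (Fin.ext h1)
  refine ⟨K, hK, hKc, fun x => (c x).image (ι ∘ e), fun x hx => ⟨?_, ?_⟩, fun x hx y hy hxy => ?_⟩
  · rw [card_image_of_injOn (hinj.mono (by exact_mod_cast (hc x hx).2)), (hc x hx).1]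
  · exact image_subset_iff.2 fun i hi => hιs _ (he i ((hc x hx).2 hi))
  · exact disjoint_image_of_injOn hinj (hc x hx).2 (hc y hy).2 (hd x hx y hy hxy)

theorem WPerf.mono {G : SimpleGraph V} {S T : Finset V} (hS : WPerf G S) (hT : T ⊆ S) :
    WPerf G T := by
  intro n
  obtain ⟨K, hK, hKc, c, hc, hd⟩ := hS fun x => if x ∈ T then n x else 0
  refine ⟨K ∩ T, inter_subset_right, hKc.subset (by simp), c, fun x hx => ?_,
    fun x hx y hy => hd x (hT hx) y (hT hy)⟩
  have := hc x (hT hx)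
  simpa [hx, ← sum_filter, filter_mem_eq_inter] using this

theorem wPerf_empty (G : SimpleGraph V) : WPerf G ∅ :=
  fun n => ⟨∅, by simp, by simp, fun _ => ∅, by simp, by simp⟩

theorem wPerf_singleton (G : SimpleGraph V) (v : V) : WPerf G {v} :=
  fun n => ⟨{v}, by simp, by simp, fun _ => range (n v), by simp, by simp⟩

theorem WPerf.attach {G : SimpleGraph V} {P Q κ : Finset V} (hP : WPerf G P) (hQ : WPerf G Q)
    (hPQ : Disjoint P Q) (hκP : κ ⊆ P) (hκ : G.IsClique (κ : Set V))
    (hc : ∀ a ∈ κ, ∀ y ∈ Q, G.Adj a y) (ha : ∀ a ∈ P, a ∉ κ → ∀ y ∈ Q, ¬ G.Adj a y) :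
    WPerf G (P ∪ Q) := by
  refine wPerf_of_bound fun n => ?_
  obtain ⟨K1, hK1, hK1c, c1, hc1, hd1⟩ := hP n
  obtain ⟨K2, hK2, hK2c, hcol⟩ := hQ.exists_coloring_in n
  have hdis : Disjoint κ K2 := disjoint_of_subset_left hκP (disjoint_of_subset_right hK2 hPQ)
  have hK3c : G.IsClique ((κ ∪ K2 : Finset V) : Set V) :=
    isClique_union hκ hK2c fun a ha b hb => hc a ha b (hK2 hb)
  set N1 := ∑ y ∈ K1, n y with hN1
  set N2 := ∑ y ∈ κ ∪ K2, n y with hN2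
  have hN2' : N2 = ∑ y ∈ κ, n y + ∑ y ∈ K2, n y := sum_union hdis
  have hcard : (κ.biUnion c1).card ≤ ∑ y ∈ κ, n y :=
    card_biUnion_le.trans (sum_le_sum fun y hy => (hc1 y (hκP hy)).1.le)
  obtain ⟨c2, hc2, hd2⟩ := hcol (range (max N1 N2) \ κ.biUnion c1) (by
    have := le_card_sdiff (κ.biUnion c1) (range (max N1 N2))
    rw [card_range] at this
    have := le_max_right N1 N2
    omega)
  have key : ∃ K ⊆ P ∪ Q, G.IsClique (K : Set V) ∧ max N1 N2 ≤ ∑ y ∈ K, n y := by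
    rcases le_total N1 N2 with h | h
    · exact ⟨κ ∪ K2, union_subset_union hκP hK2, hK3c, (max_eq_right h).le⟩
    · exact ⟨K1, hK1.trans subset_union_left, hK1c, (max_eq_left h).le⟩
  obtain ⟨K, hK, hKc, hKN⟩ := key
  have hPn : ∀ x ∈ Q, x ∉ P := fun x hx hx' => disjoint_left.1 hPQ hx' hx
  have hcross : ∀ x ∈ P, ∀ y ∈ Q, G.Adj x y → Disjoint (c1 x) (c2 y) := by
    intro x hx y hy hxy
    have hxκ : x ∈ κ := by
      by_contra h
      exact ha x hx h y hy hxy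
    refine disjoint_of_subset_right (hc2 y hy).2 (disjoint_sdiff.mono_left ?_)
    exact subset_biUnion_of_mem c1 hxκ
  refine ⟨K, hK, hKc, range (max N1 N2), by simpa using hKN, fun x => if x ∈ P then c1 x else c2 x,
    fun x hx => ?_, fun x hx y hy hxy => ?_⟩
  · by_cases hxP : x ∈ P
    · simp only [hxP, if_true]
      exact ⟨(hc1 x hxP).1, (hc1 x hxP).2.trans (range_subset_range.2 (le_max_left _ _))⟩
    · have hxQ := (mem_union.1 hx).resolve_left hxP
      simp only [hxP, if_false]
      exact ⟨(hc2 x hxQ).1, (hc2 x hxQ).2.trans sdiff_subset⟩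
  · rcases mem_union.1 hx with hx | hx <;> rcases mem_union.1 hy with hy | hy
    · simpa [hx, hy] using hd1 x hx y hy hxy
    · simpa [hx, hPn y hy] using hcross x hx y hy hxy
    · simpa [hy, hPn x hx] using (hcross y hy x hx hxy.symm).symm
    · simpa [hPn x hx, hPn y hy] using hd2 x hx y hy hxy

theorem WPerf.union {G : SimpleGraph V} {P Q : Finset V} (hP : WPerf G P) (hQ : WPerf G Q)
    (hPQ : Disjoint P Q) (ha : ∀ a ∈ P, ∀ y ∈ Q, ¬ G.Adj a y) : WPerf G (P ∪ Q) :=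
  hP.attach hQ hPQ (empty_subset P) (by simp) (by simp) fun a h _ => ha a h

theorem WPerf.join {G : SimpleGraph V} {P Q : Finset V} (hP : WPerf G P) (hQ : WPerf G Q)
    (hPQ : Disjoint P Q) (hc : ∀ a ∈ P, ∀ y ∈ Q, G.Adj a y) : WPerf G (P ∪ Q) := by
  refine wPerf_of_bound fun n => ?_
  obtain ⟨K1, hK1, hK1c, c1, hc1, hd1⟩ := hP n
  obtain ⟨K2, hK2, hK2c, hcol⟩ := hQ.exists_coloring_in n
  have hdis : Disjoint K1 K2 := disjoint_of_subset_left hK1 (disjoint_of_subset_right hK2 hPQ)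
  have hKc : G.IsClique ((K1 ∪ K2 : Finset V) : Set V) :=
    isClique_union hK1c hK2c fun a ha b hb => hc a (hK1 ha) b (hK2 hb)
  set N1 := ∑ y ∈ K1, n y
  set N2 := ∑ y ∈ K2, n y with hN2
  obtain ⟨c2, hc2, hd2⟩ := hcol (Ico N1 (N1 + N2)) (by simp)
  have hPn : ∀ x ∈ Q, x ∉ P := fun x hx hx' => disjoint_left.1 hPQ hx' hx
  have hcross : ∀ x ∈ P, ∀ y ∈ Q, Disjoint (c1 x) (c2 y) := by
    intro x hx y hy
    refine disjoint_of_subset_left (hc1 x hx).2 (disjoint_of_subset_right (hc2 y hy).2 ?_)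
    rw [disjoint_left]
    intro i hi hi'
    simp only [mem_range, mem_Ico] at hi hi'
    omega
  refine ⟨K1 ∪ K2, union_subset_union hK1 hK2, hKc, range (N1 + N2),
    by rw [sum_union hdis, card_range], fun x => if x ∈ P then c1 x else c2 x,
    fun x hx => ?_, fun x hx y hy hxy => ?_⟩
  · by_cases hxP : x ∈ P
    · simp only [hxP, if_true]
      exact ⟨(hc1 x hxP).1, (hc1 x hxP).2.trans (range_subset_range.2 (by omega))⟩
    · have hxQ := (mem_union.1 hx).resolve_left hxP
      simp only [hxP, if_false]
      refine ⟨(hc2 x hxQ).1, (hc2 x hxQ).2.trans fun i hi => ?_⟩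
      simp only [mem_range, mem_Ico] at hi ⊢
      omega
  · rcases mem_union.1 hx with hx | hx <;> rcases mem_union.1 hy with hy | hy
    · simpa [hx, hy] using hd1 x hx y hy hxy
    · simpa [hx, hPn y hy] using hcross x hx y hy
    · simpa [hy, hPn x hx] using (hcross y hy x hx).symm
    · simpa [hPn x hx, hPn y hy] using hd2 x hx y hy hxy

/-- Substituting a set `Q` for a vertex `x`. -/
theorem WPerf.substitute {G : SimpleGraph V} {B Q : Finset V} {x : V} (hB : WPerf G (insert x B))
    (hxB : x ∉ B) (hQ : WPerf G Q) (hQB : Disjoint B Q)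
    (hc : ∀ b ∈ B, G.Adj b x → ∀ y ∈ Q, G.Adj b y)
    (ha : ∀ b ∈ B, ¬ G.Adj b x → ∀ y ∈ Q, ¬ G.Adj b y) : WPerf G (B ∪ Q) := by
  refine wPerf_of_bound fun n => ?_
  obtain ⟨K2, hK2, hK2c, hcol⟩ := hQ.exists_coloring_in n
  set q := ∑ y ∈ K2, n y with hq
  obtain ⟨K1, hK1, hK1c, c1, hc1, hd1⟩ := hB (Function.update n x q)
  have hBx : ∀ b ∈ B, b ≠ x := fun b hb h => hxB (h ▸ hb)
  have hcx := hc1 x (mem_insert_self x B)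
  rw [Function.update_self] at hcx
  obtain ⟨c2, hc2, hd2⟩ := hcol (c1 x) hcx.1.ge
  have hPn : ∀ y ∈ Q, y ∉ B := fun y hy hy' => disjoint_left.1 hQB hy' hy
  have hcross : ∀ b ∈ B, ∀ y ∈ Q, G.Adj b y → Disjoint (c1 b) (c2 y) := by
    intro b hb y hy hby
    have hbx : G.Adj b x := by
      by_contra h
      exact ha b hb h y hy hby
    exact disjoint_of_subset_right (hc2 y hy).2
      (hd1 b (mem_insert_of_mem hb) x (mem_insert_self x B) hbx)
  have key : ∃ K ⊆ B ∪ Q, G.IsClique (K : Set V) ∧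
      ∑ y ∈ K1, Function.update n x q y ≤ ∑ y ∈ K, n y := by
    have herase : K1.erase x ⊆ B := fun b hb =>
      (mem_insert.1 (hK1 (erase_subset _ _ hb))).resolve_left (ne_of_mem_erase hb)
    have hsum : ∑ y ∈ K1.erase x, Function.update n x q y = ∑ y ∈ K1.erase x, n y :=
      sum_congr rfl fun y hy => Function.update_of_ne (ne_of_mem_erase hy) _ _
    by_cases hxK : x ∈ K1
    · refine ⟨K1.erase x ∪ K2, union_subset_union herase hK2, ?_, ?_⟩
      · refine isClique_union (hK1c.subset (by exact_mod_cast erase_subset _ _)) hK2c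
          fun a ha' b hb => ?_
        exact hc a (herase ha') (hK1c (mem_of_mem_erase ha') hxK (ne_of_mem_erase ha')) b (hK2 hb)
      · rw [sum_union (disjoint_of_subset_left herase (disjoint_of_subset_right hK2 hQB)),
          ← sum_erase_add _ _ hxK, hsum, Function.update_self]
    · rw [erase_eq_of_notMem hxK] at herase hsum
      exact ⟨K1, herase.trans subset_union_left, hK1c, hsum.le⟩
  obtain ⟨K, hK, hKc, hKN⟩ := key
  refine ⟨K, hK, hKc, range (∑ y ∈ K1, Function.update n x q y), by simpa using hKN,
    fun y => if y ∈ B then c1 y else c2 y, fun y hy => ?_, fun y hy z hz hyz => ?_⟩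
  · by_cases hyB : y ∈ B
    · simp only [hyB, if_true]
      have := hc1 y (mem_insert_of_mem hyB)
      rwa [Function.update_of_ne (hBx y hyB)] at this
    · have hyQ := (mem_union.1 hy).resolve_left hyB
      simp only [hyB, if_false]
      exact ⟨(hc2 y hyQ).1, (hc2 y hyQ).2.trans hcx.2⟩
  · rcases mem_union.1 hy with hy | hy <;> rcases mem_union.1 hz with hz | hz
    · simpa [hy, hz] using hd1 y (mem_insert_of_mem hy) z (mem_insert_of_mem hz) hyz
    · simpa [hy, hPn z hz] using hcross y hy z hz hyz
    · simpa [hz, hPn y hy] using (hcross z hz y hy hyz.symm).symm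
    · simpa [hPn y hy, hPn z hz] using hd2 y hy z hz hyz

theorem WPerf.isPerfect [Fintype V] {G : SimpleGraph V} {S : Finset V} (hS : WPerf G S) :
    IsPerfect (G.induce (S : Set V)) := by
  intro T
  set H := (G.induce (S : Set V)).induce (T : Set (S : Set V)) with hH
  let emb : ↥(T : Set ↥(S : Set V)) → V := fun t => t.1.1
  have hemb : Function.Injective emb := fun a b h => Subtype.ext (Subtype.ext h)
  have hadj : ∀ a b, H.Adj a b ↔ G.Adj (emb a) (emb b) := fun a b => Iff.rfl
  let T' : Finset V := univ.image emb
  have hT' : T' ⊆ S := by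
    intro x hx
    obtain ⟨t, -, rfl⟩ := mem_image.1 hx
    exact t.1.2
  obtain ⟨K, hK, hKc, c, hc, hd⟩ := hS.mono hT' fun _ => 1
  simp only [sum_const, smul_eq_mul, mul_one] at hc
  have hmem : ∀ t, emb t ∈ T' := fun t => mem_image_of_mem _ (mem_univ t)
  have hex : ∀ t, ∃ i, c (emb t) = {i} := fun t => card_eq_one.1 (hc _ (hmem t)).1
  choose col hcol using hex
  have hlt : ∀ t, col t < K.card := by
    intro t
    have := (hc _ (hmem t)).2
    rw [hcol] at this
    simpa using this
  have hcolor : H.Colorable K.card := by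
    refine ⟨SimpleGraph.Coloring.mk (fun t => (⟨col t, hlt t⟩ : Fin K.card)) ?_⟩
    intro a b hab heq
    have := hd _ (hmem a) _ (hmem b) ((hadj a b).1 hab)
    rw [hcol, hcol, Fin.mk.inj_iff.1 heq] at this
    simp at this
  let K' : Finset ↥(T : Set ↥(S : Set V)) := univ.filter fun t => emb t ∈ K
  have hK' : K'.image emb = K := by
    ext x
    simp only [mem_image, K', mem_filter, mem_univ, true_and]
    constructor
    · rintro ⟨t, ht, rfl⟩
      exact ht
    · intro hx
      obtain ⟨t, -, rfl⟩ := mem_image.1 (hK hx)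
      exact ⟨t, hx, rfl⟩
  have hcard : K'.card = K.card := by
    rw [← hK', card_image_of_injective _ hemb]
  have hcl : H.IsClique (K' : Set ↥(T : Set ↥(S : Set V))) := by
    intro a ha b hb hab
    have ha' : a ∈ K' := ha
    have hb' : b ∈ K' := hb
    exact hKc (mem_filter.1 ha').2 (mem_filter.1 hb').2 (hemb.ne hab)
  apply le_antisymm
  · refine (SimpleGraph.chromaticNumber_le_iff_colorable.2 hcolor).trans ?_
    rw [← hcard]
    exact_mod_cast hcl.card_le_cliqueNum
  · exact SimpleGraph.cliqueNum_le_chromaticNumber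

/-- The maximum `f`-weight of a subset of `S` satisfying `WPerf`. -/
noncomputable def pw (G : SimpleGraph V) (f : V → ℝ) (S : Finset V) : ℝ :=
  (S.powerset.filter (WPerf G)).sup' ⟨∅, by simp [wPerf_empty]⟩ fun P => ∑ v ∈ P, f v

theorem exists_pw_eq (G : SimpleGraph V) (f : V → ℝ) (S : Finset V) :
    ∃ P ⊆ S, WPerf G P ∧ ∑ v ∈ P, f v = pw G f S := by
  obtain ⟨P, hP, h⟩ := exists_mem_eq_sup' (s := S.powerset.filter (WPerf G))
    ⟨∅, by simp [wPerf_empty]⟩ fun P => ∑ v ∈ P, f v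
  rw [mem_filter, mem_powerset] at hP
  exact ⟨P, hP.1, hP.2, h.symm⟩

theorem sum_le_pw {G : SimpleGraph V} (f : V → ℝ) {S P : Finset V} (hPS : P ⊆ S)
    (hP : WPerf G P) : ∑ v ∈ P, f v ≤ pw G f S :=
  le_sup' (s := S.powerset.filter (WPerf G)) (fun P => ∑ v ∈ P, f v) (by simp [hPS, hP])

theorem pw_le {G : SimpleGraph V} {f : V → ℝ} {S : Finset V} {t : ℝ}
    (h : ∀ P ⊆ S, WPerf G P → ∑ v ∈ P, f v ≤ t) : pw G f S ≤ t := by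
  obtain ⟨P, hPS, hP, hs⟩ := exists_pw_eq G f S
  exact hs ▸ h P hPS hP

theorem pw_mono {G : SimpleGraph V} (f : V → ℝ) {S T : Finset V} (h : S ⊆ T) :
    pw G f S ≤ pw G f T :=
  pw_le fun _ hPS hP => sum_le_pw f (hPS.trans h) hP

theorem pw_nonneg (G : SimpleGraph V) (f : V → ℝ) (S : Finset V) : 0 ≤ pw G f S := by
  simpa using sum_le_pw f (empty_subset S) (wPerf_empty G)

theorem le_pw_of_mem {G : SimpleGraph V} (f : V → ℝ) {S : Finset V} {v : V} (hv : v ∈ S) :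
    f v ≤ pw G f S := by
  simpa using sum_le_pw f (singleton_subset_iff.2 hv) (wPerf_singleton G v)

theorem pw_add_le {G : SimpleGraph V} (f : V → ℝ) {A B : Finset V} (hAB : Disjoint A B)
    (h : ∀ a ∈ A, ∀ b ∈ B, ¬ G.Adj a b) : pw G f A + pw G f B ≤ pw G f (A ∪ B) := by
  obtain ⟨P, hPA, hP, hs⟩ := exists_pw_eq G f A
  obtain ⟨Q, hQB, hQ, hs'⟩ := exists_pw_eq G f B
  have hd := disjoint_of_subset_left hPA (disjoint_of_subset_right hQB hAB)
  rw [← hs, ← hs', ← sum_union hd]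
  exact sum_le_pw f (union_subset_union hPA hQB)
    (hP.union hQ hd fun a ha b hb => h a (hPA ha) b (hQB hb))

theorem pw_add_le_of_complete {G : SimpleGraph V} (f : V → ℝ) {A B : Finset V}
    (hAB : Disjoint A B) (h : ∀ a ∈ A, ∀ b ∈ B, G.Adj a b) :
    pw G f A + pw G f B ≤ pw G f (A ∪ B) := by
  obtain ⟨P, hPA, hP, hs⟩ := exists_pw_eq G f A
  obtain ⟨Q, hQB, hQ, hs'⟩ := exists_pw_eq G f B
  have hd := disjoint_of_subset_left hPA (disjoint_of_subset_right hQB hAB)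
  rw [← hs, ← hs', ← sum_union hd]
  exact sum_le_pw f (union_subset_union hPA hQB)
    (hP.join hQ hd fun a ha b hb => h a (hPA ha) b (hQB hb))

/-- Narrowness of an induced subgraph with exponent eight, in terms of `pw`. -/
def PwNarrow (G : SimpleGraph V) (S : Finset V) : Prop :=
  ∀ g : V → ℝ, (∀ v, 0 ≤ g v) → pw G g S ≤ 1 → ∑ v ∈ S, g v ^ 8 ≤ 1

theorem pw_smul_le {G : SimpleGraph V} (f : V → ℝ) (S : Finset V) {r : ℝ} (hr : 0 ≤ r) :
    pw G (fun v => r * f v) S ≤ r * pw G f S :=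
  pw_le fun P hPS hP => by
    rw [← mul_sum]
    exact mul_le_mul_of_nonneg_left (sum_le_pw f hPS hP) hr

theorem PwNarrow.sum_le {G : SimpleGraph V} {S : Finset V} (hS : PwNarrow G S) {g : V → ℝ}
    (hg : ∀ v, 0 ≤ g v) {t : ℝ} (ht : pw G g S ≤ t) : ∑ v ∈ S, g v ^ 8 ≤ t ^ 8 := by
  refine le_trans ?_ (pow_le_pow_left₀ (pw_nonneg G g S) ht 8)
  rcases (pw_nonneg G g S).eq_or_lt with h | h
  · refine (sum_eq_zero fun v hv => ?_).trans_le (by positivity)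
    have : g v = 0 := le_antisymm (h ▸ le_pw_of_mem g hv) (hg v)
    simp [this]
  · have := hS (fun v => (pw G g S)⁻¹ * g v) (fun v => mul_nonneg (by positivity) (hg v))
      ((pw_smul_le g S (by positivity)).trans_eq (inv_mul_cancel₀ h.ne'))
    simp only [mul_pow, ← mul_sum, inv_pow] at this
    rwa [inv_mul_le_iff₀ (by positivity), mul_one] at this

theorem PwNarrow.sum_le_mul {G : SimpleGraph V} {S : Finset V} (hS : PwNarrow G S) {g : V → ℝ}
    (hg : ∀ v, 0 ≤ g v) {t : ℝ} (ht : pw G g S ≤ t) :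
    ∑ v ∈ S, g v ^ 8 ≤ t ^ 7 * pw G g S := by
  refine (hS.sum_le hg le_rfl).trans ?_
  rw [pow_succ]
  exact mul_le_mul_of_nonneg_right (pow_le_pow_left₀ (pw_nonneg G g S) ht 7) (pw_nonneg G g S)

theorem exists_partition_of_not_linked {G : SimpleGraph V} {Y : Finset V} (hne : Y.Nonempty)
    (hY : ¬ Linked G Y) : ∃ A B : Finset V, A ∪ B = Y ∧ Disjoint A B ∧ A.Nonempty ∧ B.Nonempty ∧
      ∀ a ∈ A, ∀ b ∈ B, ¬ G.Adj a b := by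
  simp only [Linked, hne, true_and] at hY
  push Not at hY
  obtain ⟨A, hA, hAne, hAY, h⟩ := hY
  refine ⟨A, Y \ A, union_sdiff_of_subset hA, disjoint_sdiff, hAne, ?_, fun a ha b hb => ?_⟩
  · rw [sdiff_nonempty]
    exact fun h' => hAY (hA.antisymm h')
  · exact h a ha b (mem_sdiff.1 hb).1 (mem_sdiff.1 hb).2

/-- `T` is a linked set with no edges to the rest of `S`. -/
def IsComp (G : SimpleGraph V) (S T : Finset V) : Prop :=
  T ⊆ S ∧ Linked G T ∧ ∀ x ∈ T, ∀ y ∈ S, y ∉ T → ¬ G.Adj x y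

theorem sum_pow_le_of_isComp {G : SimpleGraph V} {f : V → ℝ} {c : ℝ} (hc : 0 ≤ c) (S : Finset V)
    (h : ∀ T, IsComp G S T → ∑ v ∈ T, f v ^ 8 ≤ c * pw G f T) :
    ∑ v ∈ S, f v ^ 8 ≤ c * pw G f S := by
  induction S using Finset.strongInduction with
  | H S ih =>
    rcases S.eq_empty_or_nonempty with rfl | hne
    · simpa using mul_nonneg hc (pw_nonneg G f ∅)
    by_cases hL : Linked G S
    · exact h S ⟨Subset.rfl, hL, fun x _ y hy hy' => absurd hy hy'⟩
    obtain ⟨A, B, hU, hd, ⟨a, ha⟩, ⟨b, hb⟩, hab⟩ := exists_partition_of_not_linked hne hL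
    have hA : A ⊂ S := by
      refine ⟨hU ▸ subset_union_left, fun hs => disjoint_left.1 hd (hs ?_) hb⟩
      exact hU ▸ mem_union_right A hb
    have hB : B ⊂ S := by
      refine ⟨hU ▸ subset_union_right, fun hs => disjoint_left.1 hd ha (hs ?_)⟩
      exact hU ▸ mem_union_left B ha
    have hA' := ih A hA fun T hT => h T ⟨hT.1.trans hA.1, hT.2.1, fun x hx y hy hyT => by
      rcases mem_union.1 (hU ▸ hy) with hy | hy
      exacts [hT.2.2 x hx y hy hyT, hab x (hT.1 hx) y hy]⟩
    have hB' := ih B hB fun T hT => h T ⟨hT.1.trans hB.1, hT.2.1, fun x hx y hy hyT => by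
      rcases mem_union.1 (hU ▸ hy) with hy | hy
      exacts [fun hxy => hab y hy x (hT.1 hx) hxy.symm, hT.2.2 x hx y hy hyT]⟩
    have := mul_le_mul_of_nonneg_left (pw_add_le f hd hab) hc
    rw [hU] at this
    rw [← hU, sum_union hd, hU]
    linarith

theorem sum_pow_le_of_isComp_pw_le {G : SimpleGraph V} {f : V → ℝ} (hf : ∀ v, 0 ≤ f v)
    {S : Finset V} (hN : ∀ T ⊆ S, PwNarrow G T) {t : ℝ} (ht : 0 ≤ t)
    (h : ∀ T, IsComp G S T → pw G f T ≤ t) : ∑ v ∈ S, f v ^ 8 ≤ t ^ 7 * pw G f S := by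
  exact sum_pow_le_of_isComp (by positivity) S fun T hT =>
    (hN T hT.1).sum_le_mul hf (h T hT)

/-- A set `W` attached to a set `κ` so that pairs of `κ` attached to a linked part of `W` have
a common neighbour there, and sets on which most of `κ` is not mixed have small weight. -/
structure Attached (G : SimpleGraph V) (f : V → ℝ) (κ W : Finset V) (δ : ℝ) : Prop where
  nonneg : ∀ v, 0 ≤ f v
  narrow : ∀ T ⊆ W, PwNarrow G T
  common : ∀ Y ⊆ W, Linked G Y → ∀ a ∈ κ, ∀ b ∈ κ, a ≠ b → (∃ y ∈ Y, G.Adj a y) →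
    (∃ y ∈ Y, G.Adj b y) → ∃ y ∈ Y, G.Adj a y ∧ G.Adj b y
  bound : ∀ I ⊆ W, ∀ F ⊆ κ, (∀ a ∈ κ, a ∉ F → (∀ y ∈ I, G.Adj a y) ∨ ∀ y ∈ I, ¬ G.Adj a y) →
    pw G f I ≤ δ + ∑ a ∈ F, f a

theorem Attached.helly {G : SimpleGraph V} {f : V → ℝ} {κ W : Finset V} {δ : ℝ}
    (h : Attached G f κ W δ) {L : Finset V} (hLW : L ⊆ W) (hL : Linked G L) :
    ∃ y ∈ L, ∀ a ∈ κ, ∀ z ∈ L, G.Adj a z → G.Adj a y := by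
  obtain ⟨y, hy, hmax⟩ := exists_max_image L (fun y => (κ.filter fun a => G.Adj a y).card) hL.1
  refine ⟨y, hy, fun c hc z hz hcz => ?_⟩
  by_contra hcy
  obtain ⟨Y, hY, hmin⟩ := exists_min_image
    (L.powerset.filter fun Y => Linked G Y ∧ y ∈ Y ∧ ∃ w ∈ Y, G.Adj c w) card
    ⟨L, by simpa using ⟨hL, hy, z, hz, hcz⟩⟩
  simp only [mem_filter, mem_powerset] at hY hmin
  obtain ⟨hYL, hYl, hyY, w, hw, hcw⟩ := hY
  obtain ⟨t, ht, hty, hYt⟩ := hYl.exists_erase hyY fun h => by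
    rw [h, mem_singleton] at hw
    exact hcy (hw ▸ hcw)
  have honly : ∀ w ∈ Y, G.Adj c w → w = t := by
    intro w hw hcw
    by_contra hwt
    have := hmin (Y.erase t) ⟨(erase_subset _ _).trans hYL, hYt, mem_erase.2 ⟨hty.symm, hyY⟩,
      w, mem_erase.2 ⟨hwt, hw⟩, hcw⟩
    have := card_erase_lt_of_mem ht
    omega
  have hct : G.Adj c t := honly w hw hcw ▸ hcw
  have hsub : insert c (κ.filter fun a => G.Adj a y) ⊆ κ.filter fun a => G.Adj a t := by
    refine insert_subset (mem_filter.2 ⟨hc, hct⟩) fun a ha => ?_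
    rw [mem_filter] at ha ⊢
    obtain ⟨w', hw', haw, hcw'⟩ := h.common Y (hYL.trans hLW) hYl a ha.1 c hc
      (fun hac => hcy (hac ▸ ha.2)) ⟨y, hyY, ha.2⟩ ⟨w, hw, hcw⟩
    exact ⟨ha.1, honly w' hw' hcw' ▸ haw⟩
  have h1 := card_le_card hsub
  rw [card_insert_of_notMem (by simp [hcy])] at h1
  have := hmax t (hYL ht)
  omega

theorem Attached.sum_pow_le_of_close {G : SimpleGraph V} {f : V → ℝ} {κ W : Finset V} {δ η : ℝ}
    (h : Attached G f κ W δ) (hη : 0 ≤ η) (hδ : δ ≤ η) {κ₀ : Finset V} (hκ₀ : κ₀ ⊆ κ)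
    (J : Finset V) (hJW : J ⊆ W) (hJ : ∀ y ∈ J, ∀ a ∈ κ, G.Adj a y → a ∈ κ₀)
    (hJη : ∀ y ∈ J, ∑ a ∈ κ₀ with ¬ G.Adj a y, f a ≤ η) :
    ∑ v ∈ J, f v ^ 8 ≤ 2 * (2 * η) ^ 7 * pw G f J := by
  induction J using Finset.strongInduction with
  | H J ih =>
    by_cases hcl : ∃ T, T ⊆ J ∧ Linked G T ∧ (∀ y ∈ J, y ∉ T → (∃ z ∈ T, G.Adj y z) →
      ∃ a ∈ κ, G.Adj a y ∧ ∀ z ∈ T, ¬ G.Adj a z) ∧ 2 * η < pw G f T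
    swap
    · push Not at hcl
      have := sum_pow_le_of_isComp_pw_le h.nonneg (fun T hT => h.narrow T (hT.trans hJW))
        (by positivity : 0 ≤ 2 * η) fun T hT => hcl T hT.1 hT.2.1
          fun y hy hyT ⟨z, hz, hyz⟩ => absurd hyz.symm (hT.2.2 z hz y hy hyT)
      have h2 : 0 ≤ (2 * η) ^ 7 * pw G f J := mul_nonneg (by positivity) (pw_nonneg G f J)
      linarith
    obtain ⟨T₀, hT₀⟩ := hcl
    obtain ⟨T, hT, hmin⟩ := exists_min_image (J.powerset.filter fun T => T ⊆ J ∧ Linked G T ∧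
      (∀ y ∈ J, y ∉ T → (∃ z ∈ T, G.Adj y z) → ∃ a ∈ κ, G.Adj a y ∧ ∀ z ∈ T, ¬ G.Adj a z) ∧
        2 * η < pw G f T) card ⟨T₀, mem_filter.2 ⟨mem_powerset.2 hT₀.1, hT₀⟩⟩
    obtain ⟨hTJ, hTl, hTc, hTη⟩ := (mem_filter.1 hT).2
    obtain ⟨y₁, hy₁, hy₁T⟩ := h.helly (hTJ.trans hJW) hTl
    set core := T.filter fun y => ∀ a ∈ κ, ∀ z ∈ T, G.Adj a z → G.Adj a y with hcore
    set E := J.filter fun y => y ∉ T ∧ ∃ z ∈ T, G.Adj y z with hE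
    have hy₁c : y₁ ∈ core := mem_filter.2 ⟨hy₁, hy₁T⟩
    have hET : ∀ y ∈ E, ∀ a ∈ κ, ∀ z ∈ T, G.Adj a z → G.Adj a y := by
      intro y hy a ha z hz haz
      obtain ⟨hyJ, hyT, w, hw, hyw⟩ := mem_filter.1 hy
      obtain ⟨y₂, hy₂, hy₂T⟩ := h.helly (insert_subset (hJW hyJ) (hTJ.trans hJW))
        (hTl.insert_of_adj hw hyw)
      obtain ⟨b, hb, hby, hbT⟩ := hTc y hyJ hyT ⟨w, hw, hyw⟩
      have hby₂ := hy₂T b hb y (mem_insert_self y T) hby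
      have : y₂ = y := (mem_insert.1 hy₂).resolve_right fun h' => hbT _ h' hby₂
      exact this ▸ hy₂T a ha z (mem_insert_of_mem hz) haz
    set M := (T ∪ E) \ (E ∪ core) with hM
    have hMT : ∀ y, y ∈ M ↔ y ∈ T ∧ y ∉ core := by
      intro y
      have hyE : y ∈ E → y ∉ T := fun hy => (mem_filter.1 hy).2.1
      simp only [hM, mem_sdiff, mem_union]
      clear * - hyE
      tauto
    have hMT' : M ⊆ T := fun y hy => ((hMT y).1 hy).1
    have hMw : ∑ v ∈ M, f v ^ 8 ≤ (2 * η) ^ 7 * pw G f M := by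
      refine sum_pow_le_of_isComp_pw_le h.nonneg
        (fun T' hT' => h.narrow T' (hT'.trans (hMT'.trans (hTJ.trans hJW)))) (by positivity)
        fun T' hT' => ?_
      by_contra! hlt
      have hT'T := hT'.1.trans hMT'
      refine absurd (hmin T' (mem_filter.2 ⟨mem_powerset.2 (hT'T.trans hTJ), hT'T.trans hTJ,
        hT'.2.1, fun y hyJ hyT' ⟨z, hz, hyz⟩ => ?_, hlt⟩)) ?_
      · by_cases hyT : y ∈ T
        · have hyc : y ∈ core := by
            by_contra hyc
            exact hT'.2.2 z hz y ((hMT y).2 ⟨hyT, hyc⟩) hyT' hyz.symm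
          obtain ⟨y', hy', hy'T⟩ := h.helly (hT'T.trans (hTJ.trans hJW)) hT'.2.1
          have hy'c : ∃ a ∈ κ, ∃ w ∈ T, G.Adj a w ∧ ¬ G.Adj a y' := by
            by_contra! hno
            exact ((hMT y').1 (hT'.1 hy')).2
              (mem_filter.2 ⟨hT'T hy', fun a ha w hw haw => hno a ha w hw haw⟩)
          obtain ⟨a, ha, w, hw, haw, hay'⟩ := hy'c
          exact ⟨a, ha, (mem_filter.1 hyc).2 a ha w hw haw,
            fun w hw haw => hay' (hy'T a ha w hw haw)⟩
        · obtain ⟨a, ha, hay, haT⟩ := hTc y hyJ hyT ⟨z, hT'T hz, hyz⟩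
          exact ⟨a, ha, hay, fun w hw => haT w (hT'T hw)⟩
      · exact not_le.2 (card_lt_card ⟨hT'T, fun hs => ((hMT y₁).1 (hT'.1 (hs hy₁))).2 hy₁c⟩)
    have hEcJ : E ∪ core ⊆ J :=
      union_subset (filter_subset _ _) ((filter_subset _ _).trans hTJ)
    have hEc : pw G f (E ∪ core) ≤ 2 * η := by
      have hb := h.bound (E ∪ core) (hEcJ.trans hJW) (κ₀.filter fun a => ∀ z ∈ T, ¬ G.Adj a z)
        ((filter_subset _ _).trans hκ₀) fun a ha haF => by
          by_cases ha₀ : a ∈ κ₀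
          · have hz : ∃ z ∈ T, G.Adj a z := by
              by_contra! hno
              exact haF (mem_filter.2 ⟨ha₀, hno⟩)
            obtain ⟨z, hz, haz⟩ := hz
            refine Or.inl fun y hy => ?_
            rcases mem_union.1 hy with hy | hy
            · exact hET y hy a ha z hz haz
            · exact (mem_filter.1 hy).2 a ha z hz haz
          · exact Or.inr fun y hy hay => ha₀ (hJ y (hEcJ hy) a ha hay)
      have hF : ∑ a ∈ κ₀ with ∀ z ∈ T, ¬ G.Adj a z, f a ≤ η :=
        (sum_le_sum_of_subset_of_nonneg
          (monotone_filter_right _ fun a _ (ha : ∀ z ∈ T, ¬ G.Adj a z) => ha y₁ hy₁)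
          fun _ _ _ => h.nonneg _).trans (hJη y₁ (hTJ hy₁))
      linarith
    have hEcw : ∑ v ∈ E ∪ core, f v ^ 8 ≤ (2 * η) ^ 8 :=
      (h.narrow _ (hEcJ.trans hJW)).sum_le h.nonneg hEc
    set J' := J \ (T ∪ E) with hJ'
    have hJ'J : J' ⊆ J := sdiff_subset
    have hJ'T : ∀ z ∈ T, ∀ y ∈ J', ¬ G.Adj z y := by
      intro z hz y hy hzy
      obtain ⟨hyJ, hyTE⟩ := mem_sdiff.1 hy
      rw [mem_union, not_or] at hyTE
      exact hyTE.2 (mem_filter.2 ⟨hyJ, hyTE.1, z, hz, hzy.symm⟩)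
    have hdis : Disjoint T J' := disjoint_sdiff.mono_left subset_union_left
    have hih := ih J' ⟨hJ'J, fun hs => disjoint_left.1 hdis hy₁ (hs (hTJ hy₁))⟩
      (hJ'J.trans hJW) (fun y hy => hJ y (hJ'J hy)) fun y hy => hJη y (hJ'J hy)
    have hp := (pw_add_le f hdis hJ'T).trans (pw_mono f (union_subset hTJ hJ'J))
    have hTE : T ∪ E ⊆ J := union_subset hTJ (filter_subset _ _)
    have hEcTE : E ∪ core ⊆ T ∪ E :=
      union_subset subset_union_right ((filter_subset _ _).trans subset_union_left)
    have hs1 := sum_sdiff (f := fun v => f v ^ 8) hTE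
    have hs2 := sum_sdiff (f := fun v => f v ^ 8) hEcTE
    rw [← hJ'] at hs1
    rw [← hM] at hs2
    rw [mul_assoc] at hih ⊢
    rw [pow_succ] at hEcw
    have hc : 0 ≤ (2 * η) ^ 7 := by positivity
    have h1 := mul_le_mul_of_nonneg_left (pw_mono (G := G) f hMT') hc
    have h2 := mul_le_mul_of_nonneg_left hp hc
    have h3 := mul_le_mul_of_nonneg_left hTη.le hc
    linarith

theorem Attached.sum_pow_le_of_levels {G : SimpleGraph V} {f : V → ℝ} {κ W : Finset V} {δ η : ℝ}
    (h : Attached G f κ W δ) (hη : 0 ≤ η) (hδ : δ ≤ η) (j : ℕ) (L : Finset V) (hLW : L ⊆ W)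
    (hL : ∀ y ∈ L, ∑ a ∈ κ with G.Adj a y, f a < j * η) :
    ∑ v ∈ L, f v ^ 8 ≤ j * (2 * (2 * η) ^ 7) * pw G f L := by
  induction j generalizing L with
  | zero =>
    have : L = ∅ := by
      refine eq_empty_of_forall_notMem fun y hy => ?_
      have h1 := hL y hy
      have h2 : 0 ≤ ∑ a ∈ κ with G.Adj a y, f a := sum_nonneg fun _ _ => h.nonneg _
      simp only [Nat.cast_zero, zero_mul] at h1
      linarith
    simp [this]
  | succ j ih =>
    refine sum_pow_le_of_isComp (by positivity) L fun T hT => ?_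
    have hTW := hT.1.trans hLW
    obtain ⟨y₁, hy₁, hy₁T⟩ := h.helly hTW hT.2.1
    set κ₀ := κ.filter fun a => G.Adj a y₁ with hκ₀
    set J := T.filter fun y => ∑ a ∈ κ₀ with ¬ G.Adj a y, f a ≤ η with hJ
    have hJT : J ⊆ T := filter_subset _ _
    have hsub : ∀ y ∈ T, ∀ a ∈ κ, G.Adj a y → a ∈ κ₀ := fun y hy a ha hay =>
      mem_filter.2 ⟨ha, hy₁T a ha y hy hay⟩
    have h1 := h.sum_pow_le_of_close hη hδ (filter_subset _ _ : κ₀ ⊆ κ) J (hJT.trans hTW)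
      (fun y hy => hsub y (hJT hy)) fun y hy => (mem_filter.1 hy).2
    have h2 := ih (T \ J) (sdiff_subset.trans hTW) fun y hy => by
      obtain ⟨hyT, hyJ⟩ := mem_sdiff.1 hy
      have hlt : η < ∑ a ∈ κ₀ with ¬ G.Adj a y, f a := by
        by_contra! hle
        exact hyJ (mem_filter.2 ⟨hyT, hle⟩)
      have hle := hL y₁ (hT.1 hy₁)
      have heq : κ.filter (fun a => G.Adj a y) = κ₀.filter fun a => G.Adj a y := by
        ext a
        simp only [mem_filter]
        exact ⟨fun ha => ⟨hsub y hyT a ha.1 ha.2, ha.2⟩,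
          fun ha => ⟨(mem_filter.1 ha.1).1, ha.2⟩⟩
      have hs := sum_filter_add_sum_filter_not κ₀ (fun a => G.Adj a y) f
      rw [heq]
      push_cast at hle
      linarith
    have hc : 0 ≤ 2 * (2 * η) ^ 7 := by positivity
    rw [← sum_sdiff hJT]
    have h3 := mul_le_mul_of_nonneg_left (pw_mono (G := G) f hJT) hc
    have h4 := mul_le_mul_of_nonneg_left (pw_mono (G := G) f (sdiff_subset : T \ J ⊆ T))
      (by positivity : 0 ≤ (j : ℝ) * (2 * (2 * η) ^ 7))
    push_cast
    linarith

theorem Attached.sum_pow_le {G : SimpleGraph V} {f : V → ℝ} {κ W : Finset V} {δ η : ℝ}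
    (h : Attached G f κ W δ) (hη : 0 < η) (hδ : δ ≤ η) (hκ : ∑ a ∈ κ, f a ≤ 1)
    (hW : pw G f W ≤ 1 / 2) : ∑ v ∈ W, f v ^ 8 ≤ η / 2 := by
  rcases le_total (1 / 4) η with hη' | hη'
  · have := (h.narrow W Subset.rfl).sum_le h.nonneg hW
    norm_num at this
    linarith
  have hj : 1 < ((⌊1 / η⌋₊ + 1 : ℕ) : ℝ) * η := by
    have := Nat.lt_floor_add_one (1 / η)
    rw [div_lt_iff₀ hη] at this
    exact_mod_cast this
  have hj' : ((⌊1 / η⌋₊ + 1 : ℕ) : ℝ) * η ≤ 1 + η := by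
    have := Nat.floor_le (by positivity : 0 ≤ 1 / η)
    rw [le_div_iff₀ hη] at this
    push_cast
    linarith
  have h1 := h.sum_pow_le_of_levels hη.le hδ (⌊1 / η⌋₊ + 1) W Subset.rfl fun y _ =>
    ((sum_le_sum_of_subset_of_nonneg (filter_subset _ _) fun _ _ _ => h.nonneg _).trans hκ).trans_lt hj
  set j : ℝ := ((⌊1 / η⌋₊ + 1 : ℕ) : ℝ)
  have h2 : j * (2 * (2 * η) ^ 7) * pw G f W ≤ j * (2 * (2 * η) ^ 7) * (1 / 2) :=
    mul_le_mul_of_nonneg_left hW (by positivity)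
  have h3 : j * (2 * (2 * η) ^ 7) * (1 / 2) = (j * η) * (128 * η ^ 6) := by ring
  have h4 : (j * η) * (128 * η ^ 6) ≤ 2 * (128 * η ^ 6) :=
    mul_le_mul_of_nonneg_right (by linarith) (by positivity)
  have h5 : η ^ 5 ≤ (1 / 4) ^ 5 := pow_le_pow_left₀ hη.le hη' 5
  have h6 : η ^ 6 ≤ (1 / 4) ^ 5 * η := by
    rw [pow_succ]
    exact mul_le_mul_of_nonneg_right h5 hη.le
  norm_num at h6
  linarith

theorem pow_eight_sub_le {a t δ : ℝ} (ht : 0 ≤ t) (hta : t ≤ a) (ha : a ≤ 1 / 2)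
    (hδ : a - t ≤ δ) : a ^ 8 - t ^ 8 ≤ δ / 2 := by
  have ha0 := ht.trans hta
  have h2 : a ^ 2 ≤ 1 / 4 := by nlinarith
  have ht2 : t ^ 2 ≤ 1 / 4 := by nlinarith
  have h4 : a ^ 4 ≤ 1 / 16 := by nlinarith [sq_nonneg a]
  have ht4 : t ^ 4 ≤ 1 / 16 := by nlinarith [sq_nonneg t]
  have hq : (a + t) * ((a ^ 2 + t ^ 2) * (a ^ 4 + t ^ 4)) ≤ 1 * (1 / 2 * 1) := by
    refine mul_le_mul (by linarith) (mul_le_mul (by linarith) (by linarith) ?_ ?_) ?_ ?_ <;>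
      positivity
  have : a ^ 8 - t ^ 8 = (a - t) * ((a + t) * ((a ^ 2 + t ^ 2) * (a ^ 4 + t ^ 4))) := by ring
  rw [this]
  have := mul_le_mul_of_nonneg_left hq (sub_nonneg.2 hta)
  linarith

theorem pow_eight_le_self {a : ℝ} (h0 : 0 ≤ a) (h1 : a ≤ 1) : a ^ 8 ≤ a :=
  pow_le_of_le_one h0 h1 (by norm_num)

/-- Replacing the module `X` of `U ∪ X` by a single vertex. -/
theorem sum_pow_module_le {G : SimpleGraph V} {f : V → ℝ} (hf : ∀ v, 0 ≤ f v) {U X : Finset V}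
    (hUX : Disjoint U X) (hp : pw G f (U ∪ X) ≤ 1) {x₀ : V} (hx₀ : x₀ ∈ X)
    (hN : PwNarrow G (insert x₀ U)) (hNX : PwNarrow G X)
    (hXU : ∀ u ∈ U, (∀ x ∈ X, G.Adj u x) ∨ ∀ x ∈ X, ¬ G.Adj u x) (hX : pw G f X ≤ 1 / 2) :
    ∑ v ∈ U, f v ^ 8 + ∑ v ∈ X, f v ^ 8 ≤ 1 - (1 - pw G f U) / 2 := by
  have hU1 := (pw_mono (G := G) f (subset_union_left : U ⊆ U ∪ X)).trans hp
  have hU0 := pw_nonneg G f U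
  have hX0 := pw_nonneg G f X
  set a := pw G f X with ha
  set δ := 1 - pw G f U with hδ
  set t := max (a - δ) 0 with ht
  have hxU : x₀ ∉ U := fun h => disjoint_left.1 hUX h hx₀
  have hne : ∀ v ∈ U, v ≠ x₀ := fun v hv h => hxU (h ▸ hv)
  have hsum : ∀ B ⊆ U, ∑ v ∈ B, Function.update f x₀ t v = ∑ v ∈ B, f v := fun B hB =>
    sum_congr rfl fun v hv => Function.update_of_ne (hne v (hB hv)) _ _
  have hg : pw G (Function.update f x₀ t) (insert x₀ U) ≤ 1 - δ := by
    refine pw_le fun P hPU hP => ?_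
    by_cases hxP : x₀ ∈ P
    · have hB : P.erase x₀ ⊆ U := fun v hv =>
        (mem_insert.1 (hPU (erase_subset _ _ hv))).resolve_left (ne_of_mem_erase hv)
      obtain ⟨Q, hQX, hQ, hQs⟩ := exists_pw_eq G f X
      have hd := disjoint_of_subset_left hB (disjoint_of_subset_right hQX hUX)
      have hsub := (insert_erase hxP).symm ▸ hP
      have hPQ := hsub.substitute (notMem_erase x₀ P) hQ hd
        (fun b hb hbx y hy => (hXU b (hB hb)).elim (fun h => h y (hQX hy))
          fun h => absurd hbx (h x₀ hx₀))
        fun b hb hbx y hy => (hXU b (hB hb)).elim (fun h => absurd (h x₀ hx₀) hbx)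
          fun h => h y (hQX hy)
      have h1 := sum_le_pw f (union_subset_union hB hQX) hPQ
      rw [sum_union hd, hQs] at h1
      have h2 := sum_le_pw f hB (hP.mono (erase_subset _ _))
      rw [← sum_erase_add _ _ hxP, hsum _ hB, Function.update_self]
      have : t ≤ 1 - δ - ∑ v ∈ P.erase x₀, f v := max_le (by linarith) (by linarith)
      linarith
    · have hB : P ⊆ U := fun v hv => (mem_insert.1 (hPU hv)).resolve_left fun h => hxP (h ▸ hv)
      rw [hsum P hB]
      have := sum_le_pw f hB hP
      linarith
  have h1 := hN.sum_le (fun v => by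
    rcases eq_or_ne v x₀ with rfl | h
    · rw [Function.update_self]
      exact le_max_right _ _
    · rw [Function.update_of_ne h]
      exact hf v) hg
  rw [sum_insert hxU, Function.update_self,
    sum_congr rfl fun v hv => by rw [Function.update_of_ne (hne v hv)]] at h1
  have h2 := hNX.sum_le hf ha.symm.le
  have h3 := pow_eight_le_self (a := 1 - δ) (by linarith) (by linarith)
  have h4 := pow_eight_sub_le (a := a) (t := t) (δ := δ) (le_max_right _ _)
    (max_le (by linarith) hX0) hX (by linarith [le_max_left (a - δ) 0])
  linarith

/-- A graph obtained by gluing a module `X` and a set `W` onto `U`, where `W` attaches to `U`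
only at a clique `K`, is narrow. -/
theorem sum_pow_le_one_of_amalgam {G : SimpleGraph V} {f : V → ℝ} (hf : ∀ v, 0 ≤ f v)
    {S U X W K : Finset V} (hp : pw G f S ≤ 1) (hN : ∀ T ⊂ S, PwNarrow G T)
    (hS : U ∪ X ∪ W = S) (hUX : Disjoint U X) (hUXW : Disjoint (U ∪ X) W) (hU : U.Nonempty)
    (hK : G.IsClique (K : Set V)) (hWU : ∀ u ∈ U, u ∉ K → ∀ w ∈ W, ¬ G.Adj u w)
    (hXU : ∀ u ∈ U, (∀ x ∈ X, G.Adj u x) ∨ ∀ x ∈ X, ¬ G.Adj u x) (hX2 : 1 < X.card)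
    (hX : pw G f X ≤ 1 / 2) (hW : pw G f W ≤ 1 / 2)
    (hH : ∀ Y ⊆ W, Linked G Y → ∀ a ∈ K, ∀ b ∈ K, a ≠ b → (∃ y ∈ Y, G.Adj a y) →
      (∃ y ∈ Y, G.Adj b y) → ∃ y ∈ Y, G.Adj a y ∧ G.Adj b y) : ∑ v ∈ S, f v ^ 8 ≤ 1 := by
  have hUXS : U ∪ X ⊆ S := hS ▸ subset_union_left
  have hWS : W ⊆ S := hS ▸ subset_union_right
  obtain ⟨u, hu⟩ := hU
  obtain ⟨x₀, hx₀, x₁, hx₁, hx⟩ := one_lt_card.1 hX2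
  have hUW : Disjoint U W := hUXW.mono_left subset_union_left
  have hXS : X ⊂ S := ⟨subset_union_right.trans hUXS, fun h =>
    disjoint_left.1 hUX hu (h (hUXS (mem_union_left X hu)))⟩
  have hWS' : W ⊂ S := ⟨hWS, fun h =>
    disjoint_left.1 hUW hu (h (hUXS (mem_union_left X hu)))⟩
  have hUS : insert x₀ U ⊂ S := by
    refine ⟨insert_subset (hUXS (mem_union_right U hx₀)) (subset_union_left.trans hUXS),
      fun h => ?_⟩
    rcases mem_insert.1 (h (hUXS (mem_union_right U hx₁))) with h' | h'
    · exact hx h'.symm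
    · exact disjoint_left.1 hUX h' hx₁
  have hUXw := sum_pow_module_le hf hUX ((pw_mono f hUXS).trans hp) hx₀ (hN _ hUS) (hN X hXS) hXU hX
  obtain ⟨P, hPU, hP, hPs⟩ := exists_pw_eq G f U
  have hatt : Attached G f (P.filter (· ∈ K)) W (1 - pw G f U) := by
    refine ⟨hf, fun T hT => hN T (hT.trans_ssubset hWS'), fun Y hY hYl a ha b hb =>
      hH Y hY hYl a (mem_filter.1 ha).2 b (mem_filter.1 hb).2, fun I hI F hF hc => ?_⟩
    obtain ⟨Q, hQI, hQ, hQs⟩ := exists_pw_eq G f I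
    have hFP : F ⊆ P := hF.trans (filter_subset _ _)
    have hd : Disjoint (P \ F) Q := disjoint_of_subset_left (sdiff_subset.trans hPU)
      (disjoint_of_subset_right (hQI.trans hI) hUW)
    have hPQ := (hP.mono (sdiff_subset : P \ F ⊆ P)).attach hQ hd
      (κ := (P \ F).filter fun a => a ∈ K ∧ ∀ y ∈ Q, G.Adj a y) (filter_subset _ _)
      (hK.subset fun a ha => (mem_filter.1 (mem_coe.1 ha)).2.1)
      (fun a ha => (mem_filter.1 ha).2.2) fun a ha hac y hy => by
        obtain ⟨haP, haF⟩ := mem_sdiff.1 ha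
        by_cases haK : a ∈ K
        · rcases hc a (mem_filter.2 ⟨haP, haK⟩) haF with h | h
          · exact absurd (mem_filter.2 ⟨ha, haK, fun y hy => h y (hQI hy)⟩) hac
          · exact h y (hQI hy)
        · exact hWU a (hPU haP) haK y (hI (hQI hy))
    have h1 := (sum_le_pw f (union_subset ((sdiff_subset.trans hPU).trans
      (subset_union_left.trans hUXS)) (hQI.trans (hI.trans hWS))) hPQ).trans hp
    rw [sum_union hd, hQs] at h1
    have h2 := sum_sdiff (f := f) hFP
    linarith
  have hκ : ∑ a ∈ P with a ∈ K, f a ≤ 1 :=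
    (sum_le_pw f ((filter_subset _ _).trans (hPU.trans (subset_union_left.trans hUXS)))
      (hP.mono (filter_subset _ _))).trans hp
  have hU1 := (pw_mono (G := G) f (subset_union_left.trans hUXS : U ⊆ S)).trans hp
  have hWw : ∑ v ∈ W, f v ^ 8 ≤ (1 - pw G f U) / 2 := by
    refine le_of_forall_pos_le_add fun ε hε => ?_
    have := hatt.sum_pow_le (η := 1 - pw G f U + ε) (by linarith) (by linarith) hκ hW
    linarith
  rw [← hS, sum_union hUXW, sum_union hUX]
  linarith

/-- A linked and anticomplement-linked set `C` in `S` with two nonadjacent common neighbours. -/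
structure IsSplitter (G : SimpleGraph V) (S C : Finset V) : Prop where
  subset : C ⊆ S
  linked : Linked G C
  linked_compl : Linked Gᶜ C
  one_lt : 1 < C.card
  exists_pair : ∃ d ∈ S, ∃ d' ∈ S, d ≠ d' ∧ ¬ G.Adj d d' ∧
    (∀ c ∈ C, G.Adj d c) ∧ ∀ c ∈ C, G.Adj d' c

theorem Linked.exists_adj_of_mixed {H : SimpleGraph V} {C : Finset V} (hC : Linked H C)
    {P : V → Prop} (h1 : ∃ c ∈ C, P c) (h2 : ∃ c ∈ C, ¬ P c) :
    ∃ c ∈ C, ∃ c' ∈ C, P c ∧ ¬ P c' ∧ H.Adj c c' := by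
  obtain ⟨c₁, hc₁, hP₁⟩ := h1
  obtain ⟨c₂, hc₂, hP₂⟩ := h2
  obtain ⟨c, hc, c', hc', hcc', hadj⟩ := hC.2 (C.filter P) (filter_subset _ _)
    ⟨c₁, mem_filter.2 ⟨hc₁, hP₁⟩⟩ fun h => hP₂ (mem_filter.1 (h ▸ hc₂)).2
  exact ⟨c, (mem_filter.1 hc).1, c', hc', (mem_filter.1 hc).2,
    fun h => hcc' (mem_filter.2 ⟨hc', h⟩), hadj⟩

/-- A vertex complete to `C` attached to a linked set attached to `C` has a neighbour there which
itself has a neighbour in `C`. -/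
theorem exists_adj_attached {G : SimpleGraph V} (hG : ¬ HasHoleWithHat G) {C Z : Finset V}
    (hC : Linked G C) {k : V} (hk : ∀ c ∈ C, G.Adj k c)
    (hZC : ∀ y ∈ Z, ∃ c ∈ C, ¬ G.Adj y c) (hZ : Linked G Z)
    (h1 : ∃ y ∈ Z, ∃ c ∈ C, G.Adj y c) (h2 : ∃ y ∈ Z, G.Adj k y) :
    ∃ y ∈ Z, G.Adj k y ∧ ∃ c ∈ C, G.Adj y c := by
  obtain ⟨Y, hY, hmin⟩ := exists_min_image (Z.powerset.filter fun Y => Linked G Y ∧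
    (∃ y ∈ Y, ∃ c ∈ C, G.Adj y c) ∧ ∃ y ∈ Y, G.Adj k y) card
    ⟨Z, mem_filter.2 ⟨mem_powerset_self Z, hZ, h1, h2⟩⟩
  simp only [mem_filter, mem_powerset] at hY hmin
  obtain ⟨hYZ, hYl, ⟨y₀, hy₀, c₀, hc₀, hyc₀⟩, y₁, hy₁, hky₁⟩ := hY
  by_contra! hno
  have hne : y₀ ≠ y₁ := fun h => hno y₁ (hYZ hy₁) hky₁ c₀ hc₀ (h ▸ hyc₀)
  obtain ⟨t, ht, hty, hYt⟩ := hYl.exists_erase hy₁ fun h => by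
    rw [h, mem_singleton] at hy₀
    exact hne hy₀
  have honly : ∀ w ∈ Y, ∀ c ∈ C, G.Adj w c → w = t := by
    intro w hw c hc hwc
    by_contra hwt
    have := hmin (Y.erase t) ⟨(erase_subset _ _).trans hYZ, hYt,
      ⟨w, mem_erase.2 ⟨hwt, hw⟩, c, hc, hwc⟩, y₁, mem_erase.2 ⟨hty.symm, hy₁⟩, hky₁⟩
    have := card_erase_lt_of_mem ht
    omega
  have h₀ : y₀ = t := honly y₀ hy₀ c₀ hc₀ hyc₀
  obtain ⟨c, hc, c', hc', hP, hP', hcc'⟩ :=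
    hC.exists_adj_of_mixed (P := fun c => G.Adj y₀ c) ⟨c₀, hc₀, hyc₀⟩ (hZC y₀ (hYZ hy₀))
  obtain ⟨y, hy, hky, hcy⟩ := exists_common_neighbor hG hYl (hk c hc) (hk c' hc').symm hcc'.symm
    (fun y hy hcy => hP' (by rw [h₀, ← honly y hy c' hc' hcy.symm]; exact hcy.symm))
    ⟨y₁, hy₁, hky₁⟩ ⟨y₀, hy₀, hP.symm⟩
  exact hno y (hYZ hy) hky c hc hcy.symm

theorem IsSplitter.adj_of_attached {G : SimpleGraph V} (hG : ¬ HasHoleWithHat G) {S C : Finset V}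
    (hC : IsSplitter G S C) (hmax : ∀ C', IsSplitter G S C' → C'.card ≤ C.card) {y k d : V}
    (hyS : y ∈ S) (hyC : y ∉ C) (hy1 : ∃ c ∈ C, G.Adj y c) (hy2 : ∃ c ∈ C, ¬ G.Adj y c)
    (hkS : k ∈ S) (hk : ∀ c ∈ C, G.Adj k c) (hky : G.Adj k y)
    (hdS : d ∈ S) (hd : ∀ c ∈ C, G.Adj d c) (hdk : d ≠ k) : G.Adj k d := by
  by_contra hkd
  by_cases hdy : G.Adj d y
  · obtain ⟨c₁, hc₁, hyc₁⟩ := hy1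
    obtain ⟨c₂, hc₂, hyc₂⟩ := hy2
    have hins : ∀ e, (∀ c ∈ C, G.Adj e c) → G.Adj e y → ∀ c ∈ insert y C, G.Adj e c := by
      intro e he hey c hc
      rcases mem_insert.1 hc with rfl | hc
      exacts [hey, he c hc]
    have hsp : IsSplitter G S (insert y C) :=
      ⟨insert_subset hyS hC.subset, hC.linked.insert_of_adj hc₁ hyc₁,
        hC.linked_compl.insert_of_adj hc₂
          ((SimpleGraph.compl_adj _ _ _).2 ⟨fun h => hyC (h ▸ hc₂), hyc₂⟩),
        hC.one_lt.trans_le (card_le_card (subset_insert y C)),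
        k, hkS, d, hdS, hdk.symm, hkd, hins k hk hky, hins d hd hdy⟩
    have := hmax _ hsp
    rw [card_insert_of_notMem hyC] at this
    omega
  · obtain ⟨c, hc, c', hc', hP, hP', hcc'⟩ :=
      hC.linked_compl.exists_adj_of_mixed (P := fun c => G.Adj y c) hy1 hy2
    have hlink : Linked G {d, c'} :=
      (linked_singleton G c').insert_of_adj (mem_singleton_self c') (hd c' hc')
    obtain ⟨z, hz, hcz, hkz⟩ := exists_common_neighbor hG hlink (hk c hc).symm hP hky.symm
      (by simp [G.adj_comm y d, hdy, hP']) ⟨d, by simp, (hd c hc).symm⟩ ⟨c', by simp, hk c' hc'⟩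
    rcases mem_insert.1 hz with rfl | hz
    · exact hkd hkz
    · rw [mem_singleton.1 hz] at hcz
      exact ((SimpleGraph.compl_adj _ _ _).1 hcc').2 hcz

theorem sum_pow_le_one_of_isSplitter {G : SimpleGraph V} (hG : ¬ HasHoleWithHat G) {f : V → ℝ}
    (hf : ∀ v, 0 ≤ f v) {S : Finset V} (hp : pw G f S ≤ 1) (hN : ∀ T ⊂ S, PwNarrow G T)
    (hS : ∃ C, IsSplitter G S C) : ∑ v ∈ S, f v ^ 8 ≤ 1 := by
  obtain ⟨C₁, hC₁⟩ := hS
  obtain ⟨C, hC, hmax⟩ := exists_max_image (S.powerset.filter (IsSplitter G S)) card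
    ⟨C₁, mem_filter.2 ⟨mem_powerset.2 hC₁.subset, hC₁⟩⟩
  replace hC := (mem_filter.1 hC).2
  replace hmax : ∀ C', IsSplitter G S C' → C'.card ≤ C.card := fun C' hC' =>
    hmax C' (mem_filter.2 ⟨mem_powerset.2 hC'.subset, hC'⟩)
  set D := S.filter fun d => ∀ c ∈ C, G.Adj d c with hD
  set R := S.filter fun v => v ∉ C ∧ v ∉ D with hR
  set A := R.filter fun v => ∃ Y ⊆ R, Linked G Y ∧ v ∈ Y ∧ ∃ y ∈ Y, ∃ c ∈ C, G.Adj y c with hA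
  set B := R \ A with hB
  set K := D.filter fun k => ∃ y ∈ A, G.Adj k y with hK
  set D₀ := D \ K with hD₀
  obtain ⟨d₁, hd₁S, d₂, hd₂S, hd12, hnd, hd₁C, hd₂C⟩ := hC.exists_pair
  obtain ⟨c₀, hc₀⟩ := hC.linked.1
  have hDC : ∀ d ∈ D, ∀ c ∈ C, G.Adj d c := fun d hd => (mem_filter.1 hd).2
  have hd₁D : d₁ ∈ D := mem_filter.2 ⟨hd₁S, hd₁C⟩
  have hd₂D : d₂ ∈ D := mem_filter.2 ⟨hd₂S, hd₂C⟩
  have hDS : D ⊆ S := filter_subset _ _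
  have hRS : R ⊆ S := filter_subset _ _
  have hAR : A ⊆ R := filter_subset _ _
  have hBR : B ⊆ R := sdiff_subset
  have hKD : K ⊆ D := filter_subset _ _
  have hD₀D : D₀ ⊆ D := sdiff_subset
  have hCD : Disjoint C D := disjoint_left.2 fun v hv hv' => G.loopless.irrefl v (hDC v hv' v hv)
  have hCR : Disjoint C R := disjoint_left.2 fun v hv hv' => (mem_filter.1 hv').2.1 hv
  have hDR : Disjoint D R := disjoint_left.2 fun v hv hv' => (mem_filter.1 hv').2.2 hv
  have hAB : ∀ a ∈ A, ∀ b ∈ B, ¬ G.Adj a b := by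
    intro a ha b hb hab
    obtain ⟨-, Y, hYR, hYl, haY, y, hy, c, hc, hyc⟩ := mem_filter.1 ha
    obtain ⟨hbR, hbA⟩ := mem_sdiff.1 hb
    exact hbA (mem_filter.2 ⟨hbR, insert b Y, insert_subset hbR hYR,
      hYl.insert_of_adj haY hab.symm, mem_insert_self b Y, y, mem_insert_of_mem hy, c, hc, hyc⟩)
  have hCB : ∀ c ∈ C, ∀ b ∈ B, ¬ G.Adj c b := by
    intro c hc b hb hcb
    obtain ⟨hbR, hbA⟩ := mem_sdiff.1 hb
    exact hbA (mem_filter.2 ⟨hbR, {b}, singleton_subset_iff.2 hbR, linked_singleton G b,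
      mem_singleton_self b, b, mem_singleton_self b, c, hc, hcb.symm⟩)
  have hRC : ∀ y ∈ R, ∃ c ∈ C, ¬ G.Adj y c := by
    intro y hy
    by_contra! hno
    obtain ⟨hyS, -, hyD⟩ := mem_filter.1 hy
    exact hyD (mem_filter.2 ⟨hyS, hno⟩)
  have hKK : ∀ k ∈ K, ∀ d ∈ D, d ≠ k → G.Adj k d := by
    intro k hk d hd hdk
    obtain ⟨hkD, a, ha, hka⟩ := mem_filter.1 hk
    obtain ⟨-, Y, hYR, hYl, haY, y, hy, c, hc, hyc⟩ := mem_filter.1 ha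
    obtain ⟨z, hzY, hkz, hzC⟩ := exists_adj_attached hG hC.linked (hDC k hkD)
      (fun y hy => hRC y (hYR hy)) hYl ⟨y, hy, c, hc, hyc⟩ ⟨a, haY, hka⟩
    exact hC.adj_of_attached hG hmax (hRS (hYR hzY)) (mem_filter.1 (hYR hzY)).2.1 hzC
      (hRC z (hYR hzY)) (hDS hkD) (hDC k hkD) hkz (hDS hd) (hDC d hd) hdk
  have hd₁K : d₁ ∉ K := fun h => hnd (hKK d₁ h d₂ hd₂D hd12.symm)
  have hd₂K : d₂ ∉ K := fun h => hnd (hKK d₂ h d₁ hd₁D hd12).symm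
  have hd₁ : d₁ ∈ D₀ := mem_sdiff.2 ⟨hd₁D, hd₁K⟩
  have hd₂ : d₂ ∈ D₀ := mem_sdiff.2 ⟨hd₂D, hd₂K⟩
  have hKc : G.IsClique (K : Set V) := fun a ha b hb hab => hKK a ha b (hKD hb) hab.symm
  have hKD₀ : ∀ k ∈ K, ∀ d ∈ D₀, G.Adj k d := fun k hk d hd =>
    hKK k hk d (hD₀D hd) fun h => (mem_sdiff.1 hd).2 (h ▸ hk)
  have hD₀A : ∀ d ∈ D₀, ∀ a ∈ A, ¬ G.Adj d a := fun d hd a ha hda =>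
    (mem_sdiff.1 hd).2 (mem_filter.2 ⟨hD₀D hd, a, ha, hda⟩)
  have hcover : ∀ v ∈ S, v ∈ C ∨ v ∈ D ∨ v ∈ R := fun v hv => by
    by_cases h1 : v ∈ C
    · exact Or.inl h1
    by_cases h2 : v ∈ D
    · exact Or.inr (Or.inl h2)
    exact Or.inr (Or.inr (mem_filter.2 ⟨hv, h1, h2⟩))
  have hABd : Disjoint A B := disjoint_sdiff
  have hKDd : Disjoint K D₀ := disjoint_sdiff
  have hRAB : R = A ∪ B := (union_sdiff_of_subset hAR).symm
  have hDKD : D = K ∪ D₀ := (union_sdiff_of_subset hKD).symm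
  have hSeq : S = C ∪ D ∪ R := by
    ext v
    simp only [mem_union]
    exact ⟨fun h => or_assoc.2 (hcover v h), fun h => h.elim
      (fun h => h.elim (fun h => hC.subset h) fun h => hDS h) fun h => hRS h⟩
  have hAS := hAR.trans hRS
  have hBS := hBR.trans hRS
  have hD₀S := hD₀D.trans hDS
  have hCD₀d : Disjoint C D₀ := hCD.mono_right hD₀D
  have p1 : pw G f C + pw G f D₀ ≤ 1 :=
    (pw_add_le_of_complete f hCD₀d fun c hc d hd => (hDC d (hD₀D hd) c hc).symm).trans
      ((pw_mono f (union_subset hC.subset hD₀S)).trans hp)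
  have p2 : pw G f C + pw G f B ≤ 1 :=
    (pw_add_le f (hCR.mono_right hBR) hCB).trans
      ((pw_mono f (union_subset hC.subset hBS)).trans hp)
  have p3 : pw G f D₀ + pw G f A ≤ 1 :=
    (pw_add_le f (hDR.mono hD₀D hAR) hD₀A).trans
      ((pw_mono f (union_subset hD₀S hAS)).trans hp)
  have p4 : pw G f A + pw G f B ≤ 1 :=
    (pw_add_le f hABd hAB).trans ((pw_mono f (union_subset hAS hBS)).trans hp)
  by_cases hcase : pw G f C ≤ 1 / 2 ∧ pw G f A ≤ 1 / 2
  · refine sum_pow_le_one_of_amalgam (U := D ∪ B) (X := C) (W := A) (K := K) hf hp hN ?_ ?_ ?_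
      ⟨d₁, mem_union_left _ hd₁D⟩ hKc ?_ ?_ hC.one_lt hcase.1 hcase.2 ?_
    · rw [hSeq, hRAB]
      ac_rfl
    · exact disjoint_union_left.2 ⟨hCD.symm, (hCR.mono_right hBR).symm⟩
    · exact disjoint_union_left.2 ⟨disjoint_union_left.2 ⟨hDR.mono_right hAR, hABd.symm⟩,
        hCR.mono_right hAR⟩
    · intro u hu huK w hw
      rcases mem_union.1 hu with hu | hu
      · exact hD₀A u (mem_sdiff.2 ⟨hu, huK⟩) w hw
      · exact fun h => hAB w hw u hu h.symm
    · intro u hu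
      rcases mem_union.1 hu with hu | hu
      · exact Or.inl (hDC u hu)
      · exact Or.inr fun c hc h => hCB c hc u hu h.symm
    · intro Y hYA hYl a ha b hb hab h1 h2
      exact exists_common_neighbor hG hYl (hKc ha hb hab) (hKD₀ a ha d₁ hd₁).symm
        (hKD₀ b hb d₁ hd₁).symm (fun y hy => hD₀A d₁ hd₁ y (hYA hy)) h1 h2
  · have hD₀h : pw G f D₀ ≤ 1 / 2 := by
      by_contra! h
      exact hcase ⟨by linarith, by linarith⟩
    have hBh : pw G f B ≤ 1 / 2 := by
      by_contra! h
      exact hcase ⟨by linarith, by linarith⟩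
    refine sum_pow_le_one_of_amalgam (U := K ∪ C ∪ A) (X := D₀) (W := B) (K := K) hf hp hN ?_ ?_ ?_
      ⟨c₀, mem_union_left _ (mem_union_right _ hc₀)⟩ hKc ?_ ?_
      (one_lt_card.2 ⟨d₁, hd₁, d₂, hd₂, hd12⟩) hD₀h hBh ?_
    · rw [hSeq, hRAB, hDKD]
      ac_rfl
    · exact disjoint_union_left.2 ⟨disjoint_union_left.2 ⟨hKDd, hCD₀d⟩,
        (hDR.mono hD₀D hAR).symm⟩
    · exact disjoint_union_left.2 ⟨disjoint_union_left.2 ⟨disjoint_union_left.2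
        ⟨hDR.mono hKD hBR, hCR.mono_right hBR⟩, hABd⟩, hDR.mono hD₀D hBR⟩
    · intro u hu huK w hw
      rcases mem_union.1 hu with hu | hu
      · exact hCB u ((mem_union.1 hu).resolve_left huK) w hw
      · exact hAB u hu w hw
    · intro u hu
      rcases mem_union.1 hu with hu | hu
      · rcases mem_union.1 hu with hu | hu
        · exact Or.inl (hKD₀ u hu)
        · exact Or.inl fun d hd => (hDC d (hD₀D hd) u hu).symm
      · exact Or.inr fun d hd h => hD₀A d hd u hu h.symm
    · intro Y hYB hYl a ha b hb hab h1 h2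
      exact exists_common_neighbor hG hYl (hKc ha hb hab) (hDC a (hKD ha) c₀ hc₀).symm
        (hDC b (hKD hb) c₀ hc₀).symm (fun y hy => hCB c₀ hc₀ y (hYB hy)) h1 h2

/-- `a b c d` is an induced path on four vertices. -/
structure IsPathFour (H : SimpleGraph V) (a b c d : V) : Prop where
  adj_ab : H.Adj a b
  adj_bc : H.Adj b c
  adj_cd : H.Adj c d
  not_ac : ¬ H.Adj a c
  not_ad : ¬ H.Adj a d
  not_bd : ¬ H.Adj b d

theorem IsPathFour.compl {H : SimpleGraph V} {a b c d : V} (h : IsPathFour H a b c d) :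
    IsPathFour Hᶜ b d a c := by
  obtain ⟨hab, hbc, hcd, hac, had, hbd⟩ := h
  have h1 : b ≠ d := fun h => had (h ▸ hab)
  have h2 : d ≠ a := fun h => hac (h ▸ hcd).symm
  have h3 : a ≠ c := fun h => had (h ▸ hcd)
  exact ⟨(SimpleGraph.compl_adj _ _ _).2 ⟨h1, hbd⟩,
    (SimpleGraph.compl_adj _ _ _).2 ⟨h2, fun h => had h.symm⟩,
    (SimpleGraph.compl_adj _ _ _).2 ⟨h3, hac⟩,
    fun h => ((SimpleGraph.compl_adj _ _ _).1 h).2 hab.symm,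
    fun h => ((SimpleGraph.compl_adj _ _ _).1 h).2 hbc,
    fun h => ((SimpleGraph.compl_adj _ _ _).1 h).2 hcd.symm⟩

theorem exists_isPathFour_of_cut {H : SimpleGraph V} {T A B : Finset V} (hT : Linked H T)
    {v u : V} (hv : v ∉ A ∪ B) (hTv : insert v (A ∪ B) = T)
    (hB : B.Nonempty) (hAB : ∀ a ∈ A, ∀ b ∈ B, ¬ H.Adj a b) (hu : u ∈ A) (huv : ¬ H.Adj v u) :
    ∃ a ∈ T, ∃ b ∈ T, ∃ c ∈ T, ∃ d ∈ T, IsPathFour H a b c d := by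
  have hvT : v ∈ T := hTv ▸ mem_insert_self v _
  have hAT : A ⊆ T := hTv ▸ subset_union_left.trans (subset_insert _ _)
  have hBT : B ⊆ T := hTv ▸ subset_union_right.trans (subset_insert _ _)
  have hmem : ∀ x ∈ T, x = v ∨ x ∈ A ∨ x ∈ B := fun x hx => by
    rw [← hTv, mem_insert, mem_union] at hx
    exact hx
  rw [mem_union, not_or] at hv
  obtain ⟨a', ha', a, ha, haA, haa⟩ := hT.2 (A.filter fun x => ¬ H.Adj v x)
    ((filter_subset _ _).trans hAT) ⟨u, mem_filter.2 ⟨hu, huv⟩⟩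
    fun h => hv.1 (mem_filter.1 (h ▸ hvT)).1
  obtain ⟨ha'A, hva'⟩ := mem_filter.1 ha'
  obtain ⟨x, hx, y, hy, hyB, hxy⟩ := hT.2 B hBT hB fun h => hv.2 (h ▸ hvT)
  have haA' : a ∈ A := by
    rcases hmem a ha with rfl | h | h
    exacts [absurd haa.symm hva', h, absurd haa (hAB a' ha'A a h)]
  have hva : H.Adj v a := by
    by_contra h
    exact haA (mem_filter.2 ⟨haA', h⟩)
  have hyv : y = v := by
    rcases hmem y hy with rfl | h | h
    exacts [rfl, absurd hxy.symm (hAB y h x hx), absurd h hyB]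
  exact ⟨a', hAT ha'A, a, ha, v, hvT, x, hBT hx, haa, hva.symm, (hyv ▸ hxy).symm,
    fun h => hva' h.symm, hAB a' ha'A x hx, hAB a haA' x hx⟩

theorem exists_isPathFour_of_not_linked {H : SimpleGraph V} {T : Finset V} (hT : Linked H T)
    (hT' : Linked Hᶜ T) {v : V} (hv : v ∈ T) (hne : (T.erase v).Nonempty)
    (hnl : ¬ Linked H (T.erase v)) :
    ∃ a ∈ T, ∃ b ∈ T, ∃ c ∈ T, ∃ d ∈ T, IsPathFour H a b c d := by
  obtain ⟨A, B, hU, -, hA, hB, hAB⟩ := exists_partition_of_not_linked hne hnl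
  have hvU : v ∉ A ∪ B := hU ▸ notMem_erase v T
  have hTv : insert v (A ∪ B) = T := by rw [hU, insert_erase hv]
  obtain ⟨v', hv', u, hu, huv, hadj⟩ := hT'.2 {v} (singleton_subset_iff.2 hv)
    (singleton_nonempty v) fun h => by simp [← h] at hne
  rw [mem_singleton.1 hv', SimpleGraph.compl_adj] at hadj
  rw [← hTv, mem_insert, mem_union] at hu
  rcases hu with rfl | hu | hu
  · exact absurd (mem_singleton_self u) huv
  · exact exists_isPathFour_of_cut hT hvU hTv hB hAB hu hadj.2
  · exact exists_isPathFour_of_cut hT (union_comm A B ▸ hvU) (union_comm A B ▸ hTv) hA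
      (fun b hb a ha h => hAB a ha b hb h.symm) hu hadj.2

/-- Every set on which both a graph and its complement are connected contains an induced
four-vertex path. -/
theorem exists_isPathFour {H : SimpleGraph V} (T : Finset V) (hT : Linked H T)
    (hT' : Linked Hᶜ T) (hcard : 1 < T.card) :
    ∃ a ∈ T, ∃ b ∈ T, ∃ c ∈ T, ∃ d ∈ T, IsPathFour H a b c d := by
  induction T using Finset.strongInduction with
  | H T ih =>
    obtain ⟨v, hv⟩ := hT.1
    have hce := card_erase_of_mem hv
    have hne : (T.erase v).Nonempty := card_pos.1 (by omega)
    by_cases h1 : Linked H (T.erase v)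
    · by_cases h2 : Linked Hᶜ (T.erase v)
      · rcases Nat.lt_or_ge 1 (T.erase v).card with h | h
        · obtain ⟨a, ha, b, hb, c, hc, d, hd, hp⟩ := ih _ (erase_ssubset hv) h1 h2 h
          exact ⟨a, mem_of_mem_erase ha, b, mem_of_mem_erase hb, c, mem_of_mem_erase hc,
            d, mem_of_mem_erase hd, hp⟩
        · have hsv : ({v} : Finset V) ≠ T := fun h => by simp [← h] at hcard
          obtain ⟨x, hx, y, hy, hyv, hxy⟩ := hT.2 {v} (singleton_subset_iff.2 hv)
            (singleton_nonempty v) hsv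
          obtain ⟨x', hx', y', hy', hyv', hxy'⟩ := hT'.2 {v} (singleton_subset_iff.2 hv)
            (singleton_nonempty v) hsv
          rw [mem_singleton] at hx hx' hyv hyv'
          have : y = y' := card_le_one.1 h y (mem_erase.2 ⟨hyv, hy⟩) y' (mem_erase.2 ⟨hyv', hy'⟩)
          subst hx hx' this
          exact absurd hxy ((SimpleGraph.compl_adj _ _ _).1 hxy').2
      · obtain ⟨a, ha, b, hb, c, hc, d, hd, hp⟩ :=
          exists_isPathFour_of_not_linked hT' (by rwa [compl_compl]) hv hne h2
        have := hp.compl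
        rw [compl_compl] at this
        exact ⟨b, hb, d, hd, a, ha, c, hc, this⟩
    · exact exists_isPathFour_of_not_linked hT hT' hv hne h1

theorem wPerf_of_forall_not_isPathFour {G : SimpleGraph V} (T : Finset V)
    (h : ∀ a ∈ T, ∀ b ∈ T, ∀ c ∈ T, ∀ d ∈ T, ¬ IsPathFour G a b c d) : WPerf G T := by
  induction T using Finset.strongInduction with
  | H T ih =>
    rcases T.eq_empty_or_nonempty with rfl | hne
    · exact wPerf_empty G
    rcases Nat.lt_or_ge 1 T.card with hcard | hcard
    swap
    · obtain ⟨v, rfl⟩ := card_eq_one.1 (le_antisymm hcard (card_pos.2 hne))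
      exact wPerf_singleton G v
    have hsplit : ∀ A B : Finset V, A ∪ B = T → Disjoint A B → A.Nonempty → B.Nonempty →
        WPerf G A ∧ WPerf G B := by
      intro A B hU hd ⟨a, ha⟩ ⟨b, hb⟩
      have hA : A ⊂ T := ⟨hU ▸ subset_union_left, fun hs =>
        disjoint_left.1 hd (hs (hU ▸ mem_union_right A hb)) hb⟩
      have hB : B ⊂ T := ⟨hU ▸ subset_union_right, fun hs =>
        disjoint_left.1 hd ha (hs (hU ▸ mem_union_left B ha))⟩
      exact ⟨ih A hA fun a ha b hb c hc d hd =>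
          h a (hA.1 ha) b (hA.1 hb) c (hA.1 hc) d (hA.1 hd),
        ih B hB fun a ha b hb c hc d hd => h a (hB.1 ha) b (hB.1 hb) c (hB.1 hc) d (hB.1 hd)⟩
    by_cases h1 : Linked G T
    · by_cases h2 : Linked Gᶜ T
      · obtain ⟨a, ha, b, hb, c, hc, d, hd, hp⟩ := exists_isPathFour T h1 h2 hcard
        exact absurd hp (h a ha b hb c hc d hd)
      · obtain ⟨A, B, hU, hd, hA, hB, hAB⟩ := exists_partition_of_not_linked hne h2
        obtain ⟨hPA, hPB⟩ := hsplit A B hU hd hA hB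
        rw [← hU]
        refine hPA.join hPB hd fun a ha b hb => ?_
        by_contra hab
        exact hAB a ha b hb ((SimpleGraph.compl_adj _ _ _).2
          ⟨fun h => disjoint_left.1 hd ha (h ▸ hb), hab⟩)
    · obtain ⟨A, B, hU, hd, hA, hB, hAB⟩ := exists_partition_of_not_linked hne h1
      obtain ⟨hPA, hPB⟩ := hsplit A B hU hd hA hB
      exact hU ▸ hPA.union hPB hd hAB

theorem attached_of_adj {G : SimpleGraph V} (hG : ¬ HasHoleWithHat G) {p r s v : V}
    {Y : Finset V} (hY : Linked G Y) (hvY : ∀ y ∈ Y, ¬ G.Adj v y) (hpr : ¬ G.Adj p r)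
    (hps : ¬ G.Adj p s) (hrs : G.Adj r s) (hvp : G.Adj v p) (hvr : G.Adj v r) (hvs : G.Adj v s)
    (h1 : ∃ y ∈ Y, G.Adj p y) (h2 : ∃ y ∈ Y, G.Adj r y) : ∃ y ∈ Y, G.Adj s y := by
  by_contra! hno
  obtain ⟨y, hy, hpy⟩ := h1
  obtain ⟨y', hy', hry'⟩ := h2
  obtain ⟨z, hz, hvz, hrz⟩ := exists_common_neighbor hG (hY.insert_of_adj hy hpy) hvr hvs.symm
    hrs.symm (fun w hw => (mem_insert.1 hw).elim (fun h => h ▸ fun h' => hps h'.symm)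
      fun hw => hno w hw) ⟨p, mem_insert_self p Y, hvp⟩ ⟨y', mem_insert_of_mem hy', hry'⟩
  rcases mem_insert.1 hz with rfl | hz
  · exact hpr hrz.symm
  · exact hvY z hz hvz

theorem IsPathFour.exists_complete {G : SimpleGraph V} (hG : ¬ HasHoleWithHat G) {p q r s v : V}
    (hP : IsPathFour G p q r s) {Z : Finset V} (hZ : Linked G Z) (hvZ : ∀ z ∈ Z, ¬ G.Adj v z)
    (hvp : G.Adj v p) (hvq : G.Adj v q) (hvr : G.Adj v r) (hvs : G.Adj v s)
    (hp : ∃ z ∈ Z, G.Adj p z) (hs : ∃ z ∈ Z, G.Adj s z) :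
    ∃ z ∈ Z, G.Adj p z ∧ G.Adj q z ∧ G.Adj r z ∧ G.Adj s z := by
  obtain ⟨Y, hY, hmin⟩ := exists_min_image (Z.powerset.filter fun Y => Linked G Y ∧
    (∃ z ∈ Y, G.Adj p z) ∧ ∃ z ∈ Y, G.Adj s z) card
    ⟨Z, mem_filter.2 ⟨mem_powerset_self Z, hZ, hp, hs⟩⟩
  simp only [mem_filter, mem_powerset] at hY hmin
  obtain ⟨hYZ, hYl, hYp, hYs⟩ := hY
  have hsp : ¬ G.Adj s p := fun h => hP.not_ad h.symm
  have hsq : ¬ G.Adj s q := fun h => hP.not_bd h.symm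
  have prs : ∀ Y' ⊆ Z, Linked G Y' → (∃ z ∈ Y', G.Adj p z) → (∃ z ∈ Y', G.Adj r z) →
      ∃ z ∈ Y', G.Adj s z := fun Y' hY' hl =>
    attached_of_adj hG hl (fun y hy => hvZ y (hY' hy)) hP.not_ac hP.not_ad hP.adj_cd hvp hvr hvs
  have sqp : ∀ Y' ⊆ Z, Linked G Y' → (∃ z ∈ Y', G.Adj s z) → (∃ z ∈ Y', G.Adj q z) →
      ∃ z ∈ Y', G.Adj p z := fun Y' hY' hl =>
    attached_of_adj hG hl (fun y hy => hvZ y (hY' hy)) hsq hsp hP.adj_ab.symm hvs hvq hvp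
  have hYr : ∃ z ∈ Y, G.Adj r z :=
    attached_of_adj hG hYl (fun y hy => hvZ y (hYZ hy)) hP.not_ad hP.not_ac hP.adj_cd.symm
      hvp hvs hvr hYp hYs
  have hYq : ∃ z ∈ Y, G.Adj q z :=
    attached_of_adj hG hYl (fun y hy => hvZ y (hYZ hy)) hsp hsq hP.adj_ab hvs hvp hvq hYs hYp
  obtain ⟨z, hz, hqz, hrz⟩ := exists_common_neighbor hG hYl hP.adj_bc hvq hvr
    (fun y hy => hvZ y (hYZ hy)) hYq hYr
  have hzZ : ({z} : Finset V) ⊆ Z := singleton_subset_iff.2 (hYZ hz)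
  by_cases hpz : G.Adj p z
  · have := prs {z} hzZ (linked_singleton G z) (by simpa using hpz) (by simpa using hrz)
    exact ⟨z, hYZ hz, hpz, hqz, hrz, by simpa using this⟩
  by_cases hsz : G.Adj s z
  · have := sqp {z} hzZ (linked_singleton G z) (by simpa using hsz) (by simpa using hqz)
    exact ⟨z, hYZ hz, by simpa using this, hqz, hrz, hsz⟩
  obtain ⟨y, hy, hpy⟩ := hYp
  obtain ⟨y', hy', hsy'⟩ := hYs
  obtain ⟨t, ht, htz, hYt⟩ := hYl.exists_erase hz fun h => by
    rw [h, mem_singleton] at hy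
    exact hpz (hy ▸ hpy)
  have hlt := card_erase_lt_of_mem ht
  have hzt : z ∈ Y.erase t := mem_erase.2 ⟨htz.symm, hz⟩
  have htZ : Y.erase t ⊆ Z := (erase_subset _ _).trans hYZ
  have hnot : ¬ ((∃ z ∈ Y.erase t, G.Adj p z) ∧ ∃ z ∈ Y.erase t, G.Adj s z) := fun h => by
    have := hmin _ ⟨htZ, hYt, h⟩
    omega
  have hpt : y = t := by
    by_contra hyt
    have h1 : ∃ z ∈ Y.erase t, G.Adj p z := ⟨y, mem_erase.2 ⟨hyt, hy⟩, hpy⟩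
    exact hnot ⟨h1, prs _ htZ hYt h1 ⟨z, hzt, hrz⟩⟩
  have hst : y' = t := by
    by_contra hyt
    have h1 : ∃ z ∈ Y.erase t, G.Adj s z := ⟨y', mem_erase.2 ⟨hyt, hy'⟩, hsy'⟩
    exact hnot ⟨sqp _ htZ hYt h1 ⟨z, hzt, hqz⟩, h1⟩
  have h1 := hmin {t} ⟨singleton_subset_iff.2 (hYZ ht), linked_singleton G t,
    ⟨t, mem_singleton_self t, hpt ▸ hpy⟩, t, mem_singleton_self t, hst ▸ hsy'⟩
  have h2 : 1 < Y.card := one_lt_card.2 ⟨t, ht, z, hz, htz⟩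
  rw [card_singleton] at h1
  omega

theorem IsPathFour.linked {G : SimpleGraph V} {a b c d : V} (h : IsPathFour G a b c d) :
    Linked G {a, b, c, d} :=
  (((linked_singleton G d).insert_of_adj (by simp) h.adj_cd).insert_of_adj (by simp)
    h.adj_bc).insert_of_adj (by simp) h.adj_ab

theorem IsPathFour.linked_compl {G : SimpleGraph V} {a b c d : V} (h : IsPathFour G a b c d) :
    Linked Gᶜ {a, b, c, d} := by
  have : ({a, b, c, d} : Finset V) = {b, d, a, c} := by
    ext x
    simp only [mem_insert, mem_singleton]
    tauto
  exact this ▸ h.compl.linked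

theorem sum_pow_le_one_of_not_isSplitter {G : SimpleGraph V} (hG : ¬ HasHoleWithHat G)
    {f : V → ℝ} (hf : ∀ v, 0 ≤ f v) {S : Finset V} (hp : pw G f S ≤ 1)
    (hN : ∀ T ⊂ S, PwNarrow G T) (hS : ¬ ∃ C, IsSplitter G S C) (hne : S.Nonempty) :
    ∑ v ∈ S, f v ^ 8 ≤ 1 := by
  obtain ⟨v, hv, hmax⟩ := exists_max_image S f hne
  have hm0 := hf v
  set N := S.filter fun u => G.Adj v u with hNdef
  set M := S.filter fun u => u ≠ v ∧ ¬ G.Adj v u with hM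
  have hNS : N ⊆ S := filter_subset _ _
  have hMS : M ⊆ S := filter_subset _ _
  have hvN : v ∉ N := fun h => G.loopless.irrefl v (mem_filter.1 h).2
  have hvM : v ∉ M := fun h => (mem_filter.1 h).2.1 rfl
  have hNS' : N ⊂ S := ⟨hNS, fun h => hvN (h hv)⟩
  have hMS' : M ⊂ S := ⟨hMS, fun h => hvM (h hv)⟩
  have hvS : ({v} : Finset V) ⊆ S := singleton_subset_iff.2 hv
  have hfv : f v ≤ pw G f {v} := le_pw_of_mem f (mem_singleton_self v)
  have hpN : pw G f N ≤ 1 - f v := by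
    have := (pw_add_le_of_complete (G := G) f (disjoint_singleton_left.2 hvN) fun a ha b hb => by
      rw [mem_singleton.1 ha]
      exact (mem_filter.1 hb).2).trans ((pw_mono f (union_subset hvS hNS)).trans hp)
    linarith
  have hpM : pw G f M ≤ 1 - f v := by
    have := (pw_add_le (G := G) f (disjoint_singleton_left.2 hvM) fun a ha b hb => by
      rw [mem_singleton.1 ha]
      exact (mem_filter.1 hb).2.2).trans ((pw_mono f (union_subset hvS hMS)).trans hp)
    linarith
  have hm1 : f v ≤ 1 := (le_pw_of_mem f hv).trans hp
  by_cases hZ : ∀ Z, IsComp G M Z → pw G f Z ≤ f v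
  · have h1 := (hN N hNS').sum_le hf hpN
    have h2 := sum_pow_le_of_isComp_pw_le hf (fun T hT => hN T (hT.trans_ssubset hMS')) hm0 hZ
    have h3 := mul_le_mul_of_nonneg_left hpM (pow_nonneg hm0 7)
    have h4 := pow_eight_le_self (a := 1 - f v) (by linarith) (by linarith)
    have h5 : f v ^ 7 ≤ f v := pow_le_of_le_one hm0 hm1 (by norm_num)
    have hNM : Disjoint N M := disjoint_left.2 fun u hu hu' =>
      (mem_filter.1 hu').2.2 (mem_filter.1 hu).2
    have hSeq : S = insert v (N ∪ M) := by
      ext u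
      simp only [mem_insert, mem_union, hNdef, hM, mem_filter]
      by_cases huv : u = v
      · simp [huv, hv]
      · simp only [huv, ne_eq, not_false_eq_true, true_and, false_or]
        tauto
    rw [hSeq, sum_insert (by simp [hvN, hvM]), sum_union hNM]
    have h6 : f v ^ 8 = f v ^ 7 - f v ^ 7 * (1 - f v) := by ring
    linarith
  · push Not at hZ
    obtain ⟨Z, ⟨hZM, hZl, hZc⟩, hZp⟩ := hZ
    obtain ⟨z₀, hz₀⟩ := hZl.1
    have hvZ : ∀ z ∈ Z, ¬ G.Adj v z := fun z hz => (mem_filter.1 (hZM hz)).2.2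
    have hvZ' : v ∉ Z := fun h => hvM (hZM h)
    have hZS := hZM.trans hMS
    set T := S.filter fun y => y ∉ Z ∧ ∃ z ∈ Z, G.Adj y z with hT
    have hTS : T ⊆ S := filter_subset _ _
    have hTN : T ⊆ N := fun y hy => by
      obtain ⟨hyS, hyZ, z, hz, hyz⟩ := mem_filter.1 hy
      refine mem_filter.2 ⟨hyS, ?_⟩
      by_contra hvy
      refine hZc z hz y (mem_filter.2 ⟨hyS, ?_, hvy⟩) hyZ hyz.symm
      rintro rfl
      exact hvZ z hz hyz
    have hTv : ∀ y ∈ T, G.Adj v y := fun y hy => (mem_filter.1 (hTN hy)).2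
    have hTZ : ∀ y ∈ T, ∃ z ∈ Z, G.Adj y z := fun y hy => (mem_filter.1 hy).2.2
    have hTP : WPerf G T := by
      refine wPerf_of_forall_not_isPathFour T fun a ha b hb c hc d hd hP => hS ?_
      obtain ⟨z, hz, haz, hbz, hcz, hdz⟩ := hP.exists_complete hG hZl hvZ (hTv a ha) (hTv b hb)
        (hTv c hc) (hTv d hd) (hTZ a ha) (hTZ d hd)
      refine ⟨{a, b, c, d}, ?_, hP.linked, hP.linked_compl,
        one_lt_card.2 ⟨a, by simp, b, by simp, hP.adj_ab.ne⟩, v, hv, z, hZS hz,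
        fun h => hvZ' (h ▸ hz), hvZ z hz, ?_, ?_⟩
      · intro x hx
        simp only [mem_insert, mem_singleton] at hx
        rcases hx with rfl | rfl | rfl | rfl <;> exact hTS ‹_›
      · intro x hx
        simp only [mem_insert, mem_singleton] at hx
        rcases hx with rfl | rfl | rfl | rfl <;> exact hTv _ ‹_›
      · intro x hx
        simp only [mem_insert, mem_singleton] at hx
        rcases hx with rfl | rfl | rfl | rfl
        exacts [haz.symm, hbz.symm, hcz.symm, hdz.symm]
    have hTw : ∑ y ∈ T, f y ^ 8 ≤ f v * (1 - f v) := by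
      have h1 : ∑ y ∈ T, f y ^ 8 ≤ ∑ y ∈ T, f v * f y := sum_le_sum fun y hy => by
        have hy1 := hmax y (hTS hy)
        have h7 : f y ^ 7 ≤ f y := pow_le_of_le_one (hf y) (hy1.trans hm1) (by norm_num)
        rw [pow_succ]
        exact mul_le_mul_of_nonneg_right (h7.trans hy1) (hf y)
      rw [← mul_sum] at h1
      exact h1.trans (mul_le_mul_of_nonneg_left ((sum_le_pw f hTN hTP).trans hpN) hm0)
    set R := S \ (T ∪ Z) with hR
    have hRS : R ⊆ S := sdiff_subset
    have hTZS : T ∪ Z ⊆ S := union_subset hTS hZS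
    have hTZd : Disjoint T Z := disjoint_left.2 fun y hy => (mem_filter.1 hy).2.1
    have hZR : Disjoint Z R := disjoint_sdiff.mono_left subset_union_right
    have hvR : v ∈ R := mem_sdiff.2 ⟨hv, by
      rw [mem_union, not_or]
      exact ⟨fun h => G.loopless.irrefl v (hTv v h), hvZ'⟩⟩
    have hZRa : ∀ z ∈ Z, ∀ y ∈ R, ¬ G.Adj z y := by
      intro z hz y hy hzy
      obtain ⟨hyS, hyTZ⟩ := mem_sdiff.1 hy
      rw [mem_union, not_or] at hyTZ
      exact hyTZ.1 (mem_filter.2 ⟨hyS, hyTZ.2, z, hz, hzy.symm⟩)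
    have hsum := (pw_add_le f hZR hZRa).trans ((pw_mono f (union_subset hZS hRS)).trans hp)
    have hrm : f v ≤ pw G f R := le_pw_of_mem f hvR
    have hZw := (hN Z ⟨hZS, fun h => hvZ' (h hv)⟩).sum_le hf le_rfl
    have hRw := (hN R ⟨hRS, fun h => disjoint_left.1 hZR hz₀ (h (hZS hz₀))⟩).sum_le hf le_rfl
    have hs1 := sum_sdiff (f := fun y => f y ^ 8) hTZS
    rw [← hR, sum_union hTZd] at hs1
    rw [← hs1]
    have hsq : ∀ x : ℝ, 0 ≤ x → x ≤ 1 - f v → x ^ 8 ≤ (1 - f v) * x := fun x h0 h1 => by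
      have h7 : x ^ 7 ≤ x := pow_le_of_le_one h0 (by linarith) (by norm_num)
      rw [pow_succ]
      exact mul_le_mul_of_nonneg_right (h7.trans h1) h0
    have h1 := hsq _ (pw_nonneg G f Z) (by linarith)
    have h2 := hsq _ (pw_nonneg G f R) (by linarith)
    have h3 := mul_le_mul_of_nonneg_left hsum (sub_nonneg.2 hm1)
    have h4 : f v * (1 - f v) ≤ f v * 1 := mul_le_mul_of_nonneg_left (by linarith) hm0
    linarith

theorem pwNarrow_of_not_hasHoleWithHat {G : SimpleGraph V} (hG : ¬ HasHoleWithHat G)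
    (S : Finset V) : PwNarrow G S := by
  induction S using Finset.strongInduction with
  | H S ih =>
    intro f hf hp
    rcases S.eq_empty_or_nonempty with rfl | hne
    · simp
    by_cases hS : ∃ C, IsSplitter G S C
    · exact sum_pow_le_one_of_isSplitter hG hf hp ih hS
    · exact sum_pow_le_one_of_not_isSplitter hG hf hp ih hS hne

end

theorem statement_3 :
    ∃ α : ℝ, 1 ≤ α ∧ ∀ (V : Type) [Fintype V] (G : SimpleGraph V) (f : V → ℝ),
      Critical G f α → HasHoleWithHat G := by
  refine ⟨8, by norm_num, fun V _ G f hcrit => ?_⟩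
  by_contra hG
  obtain ⟨⟨hf, hgood⟩, -, hlt⟩ := hcrit
  have := pwNarrow_of_not_hasHoleWithHat hG Finset.univ f hf
    (pw_le fun P _ hP => hgood P hP.isPerfect)
  simp only [Real.rpow_ofNat] at hlt
  linarith

end EHhat
end

section
/- Let G be a hole-with-hat-free graph, and let C, D be disjoint anticonnected subsets of V(G) that are complete to each other. Then no vertex of V(G)\(C ∪ D) is both mixed on C and mixed on D. -/
open Finset

namespace EHhat

variable {V : Type*}

/-- A vertex mixed on an anticonnected set `C` distinguishes two nonadjacent vertices of `C`. -/
theorem MixedOn.exists_nonadj {G : SimpleGraph V} {C : Set V} {v : V}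
    (hv : MixedOn G v C) (hC : AnticonnSet G C) :
    ∃ a ∈ C, ∃ b ∈ C, a ≠ b ∧ ¬ G.Adj a b ∧ G.Adj v a ∧ ¬ G.Adj v b := by
  obtain ⟨⟨a, ha, hva⟩, b, hb, hvb⟩ := hv
  obtain ⟨p⟩ := hC.preconnected ⟨a, ha⟩ ⟨b, hb⟩
  obtain ⟨d, -, hd, hd'⟩ := p.exists_boundary_dart {x | G.Adj v x} hva hvb
  have hadj := d.adj
  rw [SimpleGraph.compl_adj] at hadj
  exact ⟨d.fst, d.fst.2, d.snd, d.snd.2, fun h => hadj.1 (Subtype.ext h), hadj.2, hd, hd'⟩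

/-- An induced four-cycle `a b a' b'` with a vertex `v` adjacent to exactly `a` and `b`
is a hole with a hat. -/
theorem hasHoleWithHat_of_four_cycle {G : SimpleGraph V} {a a' b b' v : V}
    (ha : a ≠ a') (hb : b ≠ b') (haa' : ¬ G.Adj a a') (hbb' : ¬ G.Adj b b')
    (hab : G.Adj a b) (hab' : G.Adj a b') (ha'b : G.Adj a' b) (ha'b' : G.Adj a' b')
    (hva : G.Adj v a) (hvb : G.Adj v b) (hva' : ¬ G.Adj v a') (hvb' : ¬ G.Adj v b') :
    HasHoleWithHat G := by
  have hne : v ≠ a' := by rintro rfl; exact haa' hva.symm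
  have ha'a : ¬ G.Adj a' a := fun h => haa' h.symm
  have hb'b : ¬ G.Adj b' b := fun h => hbb' h.symm
  have hne' : v ≠ b' := by rintro rfl; exact hbb' hvb.symm
  let c : Fin 4 → V := ![a, b, a', b']
  refine ⟨4, c, v, (0 : Fin 4), ⟨le_rfl, ?_, ?_⟩, ?_, ?_⟩
  · change ∀ i j : Fin 4, c i = c j → i = j
    simp [c, Fin.forall_fin_succ, ha, hb, ha.symm, hb.symm, hab.ne, hab'.ne, ha'b.ne, ha'b'.ne,
      hab.ne', hab'.ne', ha'b.ne', ha'b'.ne']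
  · change ∀ i j : Fin 4, G.Adj (c i) (c j) ↔ (i - j = 1 ∨ j - i = 1)
    intro i j
    fin_cases i <;> fin_cases j <;>
      simp [c, hab, hab', ha'b, ha'b', haa', hbb', hab.symm, hab'.symm, ha'b.symm, ha'b'.symm,
        ha'a, hb'b] <;> decide
  · change ∀ j : Fin 4, v ≠ c j
    simp [c, Fin.forall_fin_succ, hva.ne, hvb.ne, hne, hne']
  · change ∀ j : Fin 4, G.Adj v (c j) ↔ (j = 0 ∨ j = 0 + 1)
    simp [c, Fin.forall_fin_succ, hva, hvb, hva', hvb']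

theorem statement_4 {V : Type} [Fintype V] (G : SimpleGraph V)
    (hG : HoleWithHatFree G) (C D : Set V) (hdisj : Disjoint C D)
    (hCanti : AnticonnSet G C) (hDanti : AnticonnSet G D)
    (hcomp : CompleteTo G C D) :
    ∀ v ∈ (C ∪ D)ᶜ, ¬ (MixedOn G v C ∧ MixedOn G v D) := by
  rintro v - ⟨hvC, hvD⟩
  obtain ⟨a, ha, a', ha', hne, hna, hva, hva'⟩ := hvC.exists_nonadj hCanti
  obtain ⟨b, hb, b', hb', hne', hnb, hvb, hvb'⟩ := hvD.exists_nonadj hDanti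
  exact hG (hasHoleWithHat_of_four_cycle hne hne' hna hnb (hcomp a ha b hb) (hcomp a ha b' hb')
    (hcomp a' ha' b hb) (hcomp a' ha' b' hb') hva hvb hva' hvb')

end EHhat
end

section
/- Let G be a hole-with-hat-free graph. Let C, D be disjoint nonempty subsets of V(G), complete to each other, such that C is connected and anticonnected, and D is anticonnected. Let P be a connected induced subgraph of G with V(P) ∩ (C ∪ D) = ∅, such that some vertex of P has a neighbour in C and no vertex of P is complete to C. Then no vertex of P is mixed on D. -/
open Finset

namespace EHhat

variable {V : Type*}

/-- A hole with a hat, described by vertices `f 0, …, f (n - 1)` in cyclic order. -/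
theorem hasHoleWithHat_of_nat {G : SimpleGraph V} {n : ℕ} (hn : 4 ≤ n) (f : ℕ → V) (v : V)
    (hinj : ∀ i j, i < j → j < n → f i ≠ f j)
    (hadj : ∀ i j, i < j → j < n → (G.Adj (f i) (f j) ↔ j = i + 1 ∨ (i = 0 ∧ j = n - 1)))
    (hv : ∀ j < n, v ≠ f j) (hvadj : ∀ j < n, (G.Adj v (f j) ↔ j = 0 ∨ j = 1)) :
    HasHoleWithHat G := by
  have : NeZero n := ⟨by omega⟩
  have : Fact (1 < n) := ⟨by omega⟩
  have hsub : ∀ x y : ZMod n, x - y = 1 ↔ x.val = (y.val + 1) % n := by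
    intro x y
    rw [sub_eq_iff_eq_add, ← (ZMod.val_injective n).eq_iff, ZMod.val_add, ZMod.val_one, add_comm]
  refine ⟨n, fun x => f x.val, v, 0, ⟨hn, ?_, ?_⟩, fun j => hv _ (ZMod.val_lt j), fun j => ?_⟩
  · intro x y hxy
    apply ZMod.val_injective n
    rcases lt_trichotomy x.val y.val with h | h | h
    · exact absurd hxy (hinj _ _ h (ZMod.val_lt y))
    · exact h
    · exact absurd hxy.symm (hinj _ _ h (ZMod.val_lt x))
  · intro x y
    rw [hsub, hsub]
    have hx := ZMod.val_lt x
    have hy := ZMod.val_lt y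
    have hmod : ∀ k < n, (k + 1) % n = if k = n - 1 then 0 else k + 1 := by
      intro k hk
      split_ifs with h
      · rw [h, Nat.sub_add_cancel (by omega), Nat.mod_self]
      · exact Nat.mod_eq_of_lt (by omega)
    rw [hmod _ hx, hmod _ hy]
    rcases lt_trichotomy x.val y.val with h | h | h
    · rw [hadj _ _ h hy]
      split_ifs <;> omega
    · simp only [h, G.irrefl, false_iff]
      split_ifs <;> omega
    · rw [G.adj_comm, hadj _ _ h hx]
      split_ifs <;> omega
  · rw [hvadj _ (ZMod.val_lt j), zero_add, ← (ZMod.val_injective n).eq_iff (a := j) (b := 0),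
      ← (ZMod.val_injective n).eq_iff (a := j) (b := 1), ZMod.val_zero, ZMod.val_one]

/-- The complement of an induced five-vertex path is a hole with a hat. -/
theorem hasHoleWithHat_of_house {G : SimpleGraph V} {a b c d e : V}
    (hab : ¬ G.Adj a b) (hbc : ¬ G.Adj b c) (hcd : ¬ G.Adj c d) (hde : ¬ G.Adj d e)
    (hac : G.Adj a c) (had : G.Adj a d) (hae : G.Adj a e)
    (hbd : G.Adj b d) (hbe : G.Adj b e) (hce : G.Adj c e) : HasHoleWithHat G := by
  have n1 : a ≠ b := fun h => hbc (h ▸ hac)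
  have n2 : e ≠ d := fun h => hcd (h ▸ hce)
  have n3 : c ≠ b := fun h => hcd (h ▸ hbd)
  have n4 : c ≠ d := fun h => hbc (h ▸ hbd)
  refine hasHoleWithHat_of_nat (n := 4) le_rfl
    (fun t => if t = 0 then a else if t = 1 then e else if t = 2 then b else d) c ?_ ?_ ?_ ?_
  · intro i j hij hj
    interval_cases j <;> interval_cases i <;>
      simp [n1, n2, hae.ne, hbe.ne.symm, had.ne, hbd.ne]
  · intro i j hij hj
    interval_cases j <;> interval_cases i <;>
      simp [hab, hae, had, hbd, hbe.symm, mt SimpleGraph.Adj.symm hde]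
  · intro j hj
    interval_cases j <;> simp [n3, n4, hac.ne.symm, hce.ne]
  · intro j hj
    interval_cases j <;> simp [hac.symm, hce, hcd, mt SimpleGraph.Adj.symm hbc]

/-- A vertex `d` outside an induced path `q 0, …, q n`, adjacent to `q 0`, `q 1` and `q n` but not
to `q (n - 1)`, yields a hole with a hat. -/
theorem hasHoleWithHat_of_path {G : SimpleGraph V} {n : ℕ} (q : ℕ → V) (d : V)
    (hinj : ∀ i j, i < j → j ≤ n → q i ≠ q j)
    (hadj : ∀ i j, i < j → j ≤ n → (G.Adj (q i) (q j) ↔ j = i + 1))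
    (hd : ∀ i ≤ n, d ≠ q i) (h0 : G.Adj d (q 0)) (h1 : G.Adj d (q 1)) (hn : G.Adj d (q n))
    (hn1 : ¬ G.Adj d (q (n - 1))) : HasHoleWithHat G := by
  classical
  have hex : ∃ a, ¬ G.Adj d (q a) := ⟨_, hn1⟩
  obtain ⟨a, ha, hamin⟩ : ∃ a, ¬ G.Adj d (q a) ∧ ∀ i < a, G.Adj d (q i) :=
    ⟨Nat.find hex, Nat.find_spec hex, fun i hi => not_not.1 (Nat.find_min hex hi)⟩
  have ha0 : a ≠ 0 := by rintro rfl; exact ha h0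
  have ha1 : a ≠ 1 := by rintro rfl; exact ha h1
  have han : a ≤ n - 1 := by
    by_contra h
    exact hn1 (hamin _ (by omega))
  have hex' : ∃ b, a < b ∧ G.Adj d (q b) := ⟨n, by omega, hn⟩
  obtain ⟨b, hab, hb, hbn, hbmin⟩ :
      ∃ b, a < b ∧ G.Adj d (q b) ∧ b ≤ n ∧ ∀ i, a < i → i < b → ¬ G.Adj d (q i) :=
    ⟨Nat.find hex', (Nat.find_spec hex').1, (Nat.find_spec hex').2,
      Nat.find_le ⟨by omega, hn⟩, fun i hi hib h => Nat.find_min hex' hib ⟨hi, h⟩⟩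
  refine hasHoleWithHat_of_nat (n := b - a + 3) (by omega)
    (fun t => if t = 0 then d else q (a - 2 + t)) (q (a - 2)) ?_ ?_ ?_ ?_
  · intro i j hij hj
    have hj0 : j ≠ 0 := by omega
    by_cases hi0 : i = 0
    · simpa [hi0, hj0] using hd _ (by omega)
    · simpa [hi0, hj0] using hinj _ _ (by omega) (by omega)
  · intro i j hij hj
    have hj0 : j ≠ 0 := by omega
    by_cases hi0 : i = 0
    · simp only [hi0, hj0, if_true, if_false, true_and]
      by_cases hj1 : j = 1
      · simpa [hj1] using hamin _ (by omega)
      by_cases hjb : j = b - a + 2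
      · have : a - 2 + j = b := by omega
        rw [this]
        exact iff_of_true hb (by omega)
      · refine iff_of_false ?_ (by omega)
        by_cases hja : a - 2 + j = a
        · rwa [hja]
        · exact hbmin _ (by omega) (by omega)
    · simp only [hi0, hj0, if_false, false_and, or_false]
      rw [hadj _ _ (by omega) (by omega)]
      omega
  · intro j hj
    by_cases hj0 : j = 0
    · simpa [hj0] using (hd _ (by omega)).symm
    · simpa [hj0] using hinj _ _ (by omega) (by omega)
  · intro j hj
    by_cases hj0 : j = 0
    · simpa [hj0] using (hamin _ (by omega)).symm
    · simp only [hj0, if_false, false_or]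
      rw [hadj _ _ (by omega) (by omega)]
      omega

theorem exists_adj_of_connected {W : Type*} {H : SimpleGraph W} (hH : H.Connected) {Q : W → Prop}
    {x y : W} (hx : Q x) (hy : ¬ Q y) : ∃ a b, H.Adj a b ∧ Q a ∧ ¬ Q b := by
  obtain ⟨w⟩ := hH.preconnected x y
  obtain ⟨e, -, h1, h2⟩ := w.exists_boundary_dart {z | Q z} hx hy
  exact ⟨e.fst, e.snd, e.adj, h1, h2⟩

theorem ConnSet.exists_adj {G : SimpleGraph V} {X : Set V} (hX : ConnSet G X) {Q : V → Prop}
    {x y : V} (hxX : x ∈ X) (hyX : y ∈ X) (hx : Q x) (hy : ¬ Q y) :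
    ∃ a ∈ X, ∃ b ∈ X, G.Adj a b ∧ Q a ∧ ¬ Q b := by
  obtain ⟨a, b, h, ha, hb⟩ :=
    exists_adj_of_connected hX (Q := fun z => Q z) (x := ⟨x, hxX⟩) (y := ⟨y, hyX⟩) hx hy
  exact ⟨a, a.2, b, b.2, h, ha, hb⟩

theorem AnticonnSet.exists_not_adj {G : SimpleGraph V} {X : Set V} (hX : AnticonnSet G X)
    {Q : V → Prop} {x y : V} (hxX : x ∈ X) (hyX : y ∈ X) (hx : Q x) (hy : ¬ Q y) :
    ∃ a ∈ X, ∃ b ∈ X, ¬ G.Adj a b ∧ Q a ∧ ¬ Q b := by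
  obtain ⟨a, b, h, ha, hb⟩ :=
    exists_adj_of_connected hX (Q := fun z => Q z) (x := ⟨x, hxX⟩) (y := ⟨y, hyX⟩) hx hy
  exact ⟨a, a.2, b, b.2, (SimpleGraph.compl_adj _ _ _ |>.1 h).2, ha, hb⟩

/-- `f 0, …, f n` is a walk of `G` inside `P` from `A` to `B`. -/
def IsLink (G : SimpleGraph V) (P A B : Set V) (n : ℕ) (f : ℕ → V) : Prop :=
  f 0 ∈ A ∧ f n ∈ B ∧ (∀ i ≤ n, f i ∈ P) ∧ ∀ i < n, G.Adj (f i) (f (i + 1))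

theorem ConnSet.exists_isLink {G : SimpleGraph V} {P A B : Set V} (hP : ConnSet G P) {x y : V}
    (hxP : x ∈ P) (hyP : y ∈ P) (hx : x ∈ A) (hy : y ∈ B) : ∃ n f, IsLink G P A B n f := by
  obtain ⟨w⟩ := hP.preconnected ⟨x, hxP⟩ ⟨y, hyP⟩
  refine ⟨w.length, fun i => (w.getVert i : V), by simpa using hx, by simpa using hy,
    fun i _ => (w.getVert i).2, fun i hi => ?_⟩
  simpa using w.adj_getVert_succ hi

/-- A shortest walk from `A` to `B` is an induced path meeting `A` and `B` only at its ends. -/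
theorem IsLink.induced_of_minimal {G : SimpleGraph V} {P A B : Set V} {n : ℕ} {f : ℕ → V}
    (h : IsLink G P A B n f) (hmin : ∀ m < n, ∀ g, ¬ IsLink G P A B m g) :
    (∀ i, 0 < i → i ≤ n → f i ∉ A) ∧ (∀ i < n, f i ∉ B) ∧
    (∀ i j, i < j → j ≤ n → f i ≠ f j) ∧
    ∀ i j, i < j → j ≤ n → (G.Adj (f i) (f j) ↔ j = i + 1) := by
  obtain ⟨hA, hB, hP, hadj⟩ := h
  -- replacing the segment of the walk strictly between positions `i` and `i + s + 1`
  have shortcut : ∀ i s, 0 < s → i + s < n → ¬ G.Adj (f i) (f (i + s + 1)) := by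
    intro i s hs hin hij
    refine hmin (n - s) (by omega) (fun t => if t ≤ i then f t else f (t + s)) ⟨?_, ?_, ?_, ?_⟩
    · simpa using hA
    · have h1 : ¬ n - s ≤ i := by omega
      have h2 : n - s + s = n := by omega
      simpa only [h1, if_false, h2] using hB
    · intro t ht
      dsimp only
      split_ifs <;> exact hP _ (by omega)
    · intro t ht
      rcases lt_trichotomy t i with hti | rfl | hti
      · have h2 : t + 1 ≤ i := hti
        simpa only [hti.le, h2, if_true] using hadj t (by omega)
      · have h2 : ¬ t + 1 ≤ t := by omega
        simpa only [le_refl, h2, if_true, if_false, Nat.add_right_comm t 1 s] using hij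
      · have h1 : ¬ t ≤ i := by omega
        have h2 : ¬ t + 1 ≤ i := by omega
        simpa only [h1, h2, if_false, Nat.add_right_comm t 1 s] using hadj (t + s) (by omega)
  have hAonly : ∀ i, 0 < i → i ≤ n → f i ∉ A := by
    intro i hi hin hiA
    refine hmin (n - i) (by omega) (fun t => f (i + t)) ⟨hiA, ?_, ?_, ?_⟩
    · simpa only [Nat.add_sub_cancel' hin] using hB
    · exact fun t ht => hP _ (by omega)
    · exact fun t ht => hadj (i + t) (by omega)
  have hBonly : ∀ i < n, f i ∉ B := fun i hi hiB =>
    hmin i hi f ⟨hA, hiB, fun t ht => hP _ (by omega), fun t ht => hadj _ (by omega)⟩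
  refine ⟨hAonly, hBonly, ?_, ?_⟩
  · intro i j hij hj heq
    rcases hj.eq_or_lt with rfl | hjn
    · exact hBonly i hij (heq ▸ hB)
    · have hadj' := hadj j hjn
      rw [← heq] at hadj'
      obtain ⟨s, rfl⟩ := Nat.exists_eq_add_of_lt hij
      exact shortcut i (s + 1) (by omega) (by omega) hadj'
  · intro i j hij hj
    constructor
    · intro h
      by_contra hne
      obtain ⟨s, rfl⟩ := Nat.exists_eq_add_of_lt hij
      exact shortcut i s (by omega) (by omega) h
    · rintro rfl
      exact hadj i (by omega)

theorem statement_7 {V : Type} [Fintype V] (G : SimpleGraph V)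
    (hG : HoleWithHatFree G) (C D : Set V) (hCne : C.Nonempty) (hDne : D.Nonempty)
    (hdisj : Disjoint C D) (hcomp : CompleteTo G C D)
    (hCconn : ConnSet G C) (hCanti : AnticonnSet G C) (hDanti : AnticonnSet G D)
    (P : Set V) (hP : P ⊆ (C ∪ D)ᶜ) (hPconn : ConnSet G P)
    (hattach : ∃ p ∈ P, ∃ c ∈ C, G.Adj p c)
    (hnotcomp : ∀ p ∈ P, ¬ VertCompleteTo G p C) :
    ∀ v ∈ P, ¬ MixedOn G v D := by
  classical
  rintro v hvP hvD
  obtain ⟨p, hpP, hpC⟩ := hattach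
  have hex := hPconn.exists_isLink (A := {x | ∃ c ∈ C, G.Adj x c}) (B := {x | MixedOn G x D})
    hpP hvP hpC hvD
  obtain ⟨f, hf⟩ := Nat.find_spec hex
  have hmin := fun m hm g hg => Nat.find_min hex (m := m) hm ⟨g, hg⟩
  generalize Nat.find hex = n at hf hmin
  obtain ⟨hAonly, hBonly, hinj, hadj⟩ := hf.induced_of_minimal hmin
  obtain ⟨⟨c₀, hc₀, hfc₀⟩, ⟨⟨d₀, hd₀, hfd₀⟩, d₁, hd₁, hfd₁⟩, hfP, -⟩ := hf
  obtain ⟨c₁, hc₁, hfc₁⟩ : ∃ c ∈ C, ¬ G.Adj (f 0) c := by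
    simpa [VertCompleteTo] using hnotcomp _ (hfP 0 (by omega))
  obtain ⟨d, hd, d', hd', hdd', hfd, hfd'⟩ :=
    hDanti.exists_not_adj (Q := fun z => G.Adj (f n) z) hd₀ hd₁ hfd₀ hfd₁
  have hnC : ∀ i ≤ n, ∀ x ∈ C, f i ≠ x := fun i hi x hx h =>
    hP (hfP i hi) (Or.inl (h ▸ hx))
  have hnD : ∀ i ≤ n, ∀ x ∈ D, x ≠ f i := fun i hi x hx h =>
    hP (hfP i hi) (Or.inr (h ▸ hx))
  rcases Nat.eq_zero_or_pos n with rfl | hn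
  · obtain ⟨c, hc, c', hc', hcc', hfc, hfc'⟩ :=
      hCanti.exists_not_adj (Q := fun z => G.Adj (f 0) z) hc₀ hc₁ hfc₀ hfc₁
    exact hG (hasHoleWithHat_of_house (a := c) (b := c') (c := f 0) (d := d') (e := d)
      hcc' (mt SimpleGraph.Adj.symm hfc') hfd' (mt SimpleGraph.Adj.symm hdd') hfc.symm (hcomp _ hc _ hd') (hcomp _ hc _ hd)
      (hcomp _ hc' _ hd') (hcomp _ hc' _ hd) hfd)
  have hanti : ∀ i, 0 < i → i ≤ n → ∀ x ∈ C, ¬ G.Adj (f i) x := fun i hi hin x hx h =>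
    hAonly i hi hin ⟨x, hx, h⟩
  obtain ⟨m, rfl⟩ : ∃ m, n = m + 1 := ⟨n - 1, by omega⟩
  by_cases hmd : G.Adj (f m) d
  · have hmd' : G.Adj (f m) d' := by
      by_contra h
      exact hBonly m (by omega) ⟨⟨d, hd, hmd⟩, d', hd', h⟩
    have hmc₁ : ¬ G.Adj (f m) c₁ := by
      rcases Nat.eq_zero_or_pos m with rfl | hm
      · exact hfc₁
      · exact hanti m hm (by omega) _ hc₁
    exact hG (hasHoleWithHat_of_house (a := f m) (b := c₁) (c := f (m + 1)) (d := d') (e := d)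
      hmc₁ (mt SimpleGraph.Adj.symm (hanti _ hn le_rfl _ hc₁)) hfd' (mt SimpleGraph.Adj.symm hdd')
      ((hadj _ _ (by omega) le_rfl).2 rfl) hmd' hmd (hcomp _ hc₁ _ hd') (hcomp _ hc₁ _ hd) hfd)
  · obtain ⟨c, hc, c', hc', hcc', hfc, hfc'⟩ :=
      hCconn.exists_adj (Q := fun z => G.Adj (f 0) z) hc₀ hc₁ hfc₀ hfc₁
    let q : ℕ → V := fun t => Nat.casesOn t c' fun t => Nat.casesOn t c f
    have hdC : ∀ x ∈ C, d ≠ x := fun x hx => (hcomp x hx d hd).ne.symm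
    refine hG (hasHoleWithHat_of_path (n := m + 3) q d ?_ ?_ ?_ (hcomp _ hc' _ hd).symm
      (hcomp _ hc _ hd).symm hfd.symm (mt SimpleGraph.Adj.symm hmd))
    · rintro (_ | _ | i) (_ | _ | j) hij hj <;> try omega
      · exact hcc'.ne.symm
      · exact (hnC j (by omega) _ hc').symm
      · exact (hnC j (by omega) _ hc).symm
      · exact hinj i j (by omega) (by omega)
    · rintro (_ | _ | i) (_ | _ | j) hij hj <;> try omega
      · exact iff_of_true hcc'.symm rfl
      · refine iff_of_false (fun h => ?_) (by omega)
        rcases Nat.eq_zero_or_pos j with rfl | hj0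
        · exact hfc' h.symm
        · exact hanti j hj0 (by omega) _ hc' h.symm
      · rcases Nat.eq_zero_or_pos j with rfl | hj0
        · exact iff_of_true hfc.symm rfl
        · exact iff_of_false (fun h => hanti j hj0 (by omega) _ hc h.symm) (by omega)
      · exact (hadj i j (by omega) (by omega)).trans (by omega)
    · rintro (_ | _ | i) hi
      · exact hdC _ hc'
      · exact hdC _ hc
      · exact hnD i (by omega) _ hd

end EHhat
end
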